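/- arXiv:1511.07253 — 3 statements merged into one kernel-verified Lean document; each statement's English description precedes it below -/
import Mathlib

section
/- In PG(5,4), the largest maximal partial line spread that is not a spread has size 270; that is, there exists a maximal partial line spread of size 270, and every maximal partial line spread of size greater than 270 has size 273 (the size of a spread), so the largest maximal partial line spread of positive deficiency has deficiency δ = √q + 1 = 3. -/
/-- A partial line spread of PG(n-1, q): a set of lines (2-dimensional linear
subspaces of `F^n`) that are pairwise skew, i.e. pairwise intersecting only
in the zero subspace. -/
def IsPartialLineSpread (F : Type*) [Field F] (n : ℕ)
    (S : Set (Submodule F (Fin n → F))) : Prop :=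
  (∀ l ∈ S, Module.finrank F ↥l = 2) ∧
  (∀ l ∈ S, ∀ l' ∈ S, l ≠ l' → l ⊓ l' = ⊥)

/-- A maximal partial line spread: a partial line spread such that every line
of the space meets some line of the spread nontrivially (equivalently, it
cannot be extended to a larger partial line spread). -/
def IsMaximalPartialLineSpread (F : Type*) [Field F] (n : ℕ)
    (S : Set (Submodule F (Fin n → F))) : Prop :=
  IsPartialLineSpread F n S ∧
  ∀ m : Submodule F (Fin n → F), Module.finrank F ↥m = 2 → ∃ l ∈ S, m ⊓ l ≠ ⊥

section Holes

open Module Finset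
open scoped Classical

variable {F V : Type*} [Field F] [AddCommGroup V] [Module F V] [Fintype V]

/-- The nonzero vectors of a subspace. -/
noncomputable def nonzeroVectors (W : Submodule F V) : Finset V :=
  univ.filter fun v => v ∈ W ∧ v ≠ 0

/-- The nonzero vectors that lie on no member of `S`. -/
noncomputable def holes (S : Finset (Submodule F V)) : Finset V :=
  univ.filter fun v => v ≠ 0 ∧ ∀ l ∈ S, v ∉ l

/-- The holes in a subspace. -/
noncomputable def holesIn (S : Finset (Submodule F V)) (W : Submodule F V) : Finset V :=
  (holes S).filter fun v => v ∈ W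

/-- The linear functionals vanishing on a subspace. -/
noncomputable def annihilating [Fintype (Dual F V)] (W : Submodule F V) : Finset (Dual F V) :=
  univ.filter fun f => f ∈ W.dualAnnihilator

/-- The nonzero vectors of a subspace are either holes or lie on exactly one member of a family
of pairwise skew subspaces. -/
lemma card_holesIn_add_sum (S : Finset (Submodule F V))
    (hS : ∀ l ∈ S, ∀ l' ∈ S, l ≠ l' → l ⊓ l' = ⊥) (W : Submodule F V) :
    #(holesIn S W) + ∑ l ∈ S, #(nonzeroVectors (l ⊓ W)) = #(nonzeroVectors W) := by
  rw [← Finset.card_biUnion, ← Finset.card_union_of_disjoint]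
  · congr 1
    ext v
    simp only [holesIn, holes, nonzeroVectors, mem_union, mem_filter, mem_univ, true_and,
      mem_biUnion, Submodule.mem_inf]
    by_cases h : ∃ l ∈ S, v ∈ l
    · obtain ⟨l, hl, hv⟩ := h
      constructor
      · rintro (h | ⟨l, -, h, h0⟩)
        · exact ⟨h.2, h.1.1⟩
        · exact ⟨h.2, h0⟩
      · rintro ⟨h, h0⟩
        exact Or.inr ⟨l, hl, ⟨hv, h⟩, h0⟩
    · push Not at h
      constructor
      · rintro (h | ⟨l, -, h, h0⟩)
        · exact ⟨h.2, h.1.1⟩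
        · exact ⟨h.2, h0⟩
      · rintro ⟨h', h0⟩
        exact Or.inl ⟨⟨h0, h⟩, h'⟩
  · rw [Finset.disjoint_left]
    intro v hv hv'
    simp only [holesIn, holes, nonzeroVectors, mem_filter, mem_univ, true_and,
      mem_biUnion, Submodule.mem_inf] at hv hv'
    obtain ⟨l, hl, h, -⟩ := hv'
    exact hv.1.2 l hl h.1
  · intro l hl l' hl' hne
    rw [Function.onFun, Finset.disjoint_left]
    intro v hv hv'
    simp only [nonzeroVectors, mem_filter, mem_univ, true_and, Submodule.mem_inf] at hv hv'
    have : v ∈ l ⊓ l' := ⟨hv.1.1, hv'.1.1⟩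
    rw [hS l hl l' hl' hne] at this
    exact hv.2 (by simpa using this)

lemma holesIn_top (S : Finset (Submodule F V)) : holesIn S ⊤ = holes S := by
  simp [holesIn]

lemma holesIn_mono (S : Finset (Submodule F V)) {W W' : Submodule F V} (h : W ≤ W') :
    holesIn S W ⊆ holesIn S W' := by
  intro v hv
  simp only [holesIn, mem_filter] at hv ⊢
  exact ⟨hv.1, h hv.2⟩

lemma holesIn_span_singleton {S : Finset (Submodule F V)} {p : V} (hp : p ∈ holes S) :
    holesIn S (Submodule.span F {p}) = nonzeroVectors (Submodule.span F {p}) := by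
  ext v
  simp only [holesIn, holes, nonzeroVectors, mem_filter, mem_univ, true_and] at hp ⊢
  constructor
  · rintro ⟨h, h'⟩
    exact ⟨h', h.1⟩
  · rintro ⟨h, h0⟩
    refine ⟨⟨h0, fun l hl hv => hp.2 l hl ?_⟩, h⟩
    obtain ⟨c, rfl⟩ := Submodule.mem_span_singleton.1 h
    have hc : c ≠ 0 := by
      rintro rfl
      simp at h0
    exact (Submodule.smul_mem_iff l hc).1 hv

lemma finrank_span_sup_span {S : Finset (Submodule F V)} {p u : V} (hp : p ∈ holes S)
    (hu : u ∉ Submodule.span F {p}) :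
    finrank F (Submodule.span F {p} ⊔ Submodule.span F {u} : Submodule F V) = 2 := by
  simp only [holes, mem_filter] at hp
  rw [Submodule.finrank_sup_span_singleton hu, finrank_span_singleton hp.2.1]

lemma mem_annihilating [Fintype (Dual F V)] {W : Submodule F V} {f : Dual F V} :
    f ∈ annihilating W ↔ W ≤ LinearMap.ker f := by
  simp [annihilating, Submodule.mem_dualAnnihilator, SetLike.le_def]

lemma annihilating_sup_span [Fintype (Dual F V)] (W : Submodule F V) (v : V) :
    (annihilating W).filter (fun f => v ∈ LinearMap.ker f) =
      annihilating (W ⊔ Submodule.span F {v}) := by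
  ext f
  simp [mem_annihilating]

/-- The second moment of the number of holes in hyperplanes through `W`. -/
lemma sum_card_holesIn_ker_sq [Fintype (Dual F V)] (S : Finset (Submodule F V))
    (W : Submodule F V) :
    ∑ f ∈ annihilating W, #(holesIn S (LinearMap.ker f)) ^ 2 =
      ∑ u ∈ holes S, ∑ f ∈ annihilating (W ⊔ Submodule.span F {u}),
        #(holesIn S (LinearMap.ker f)) := by
  simp_rw [← annihilating_sup_span, Finset.sum_filter]
  rw [Finset.sum_comm]
  refine Finset.sum_congr rfl fun f _ => ?_
  rw [← Finset.sum_filter, Finset.sum_const, smul_eq_mul, sq]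
  rfl

variable [Fintype F]

lemma card_nonzeroVectors_add_one (W : Submodule F V) :
    #(nonzeroVectors W) + 1 = Fintype.card F ^ finrank F W := by
  rw [← Module.card_eq_pow_finrank (K := F) (V := W), Fintype.card_subtype,
    ← Finset.card_erase_add_one (s := univ.filter fun v => v ∈ W) (a := (0 : V)) (by simp)]
  congr 2
  ext v
  simp [nonzeroVectors, and_comm]

lemma card_nonzeroVectors_inf_ker {l : Submodule F V} (hl : finrank F l = 2) (f : Dual F V) :
    #(nonzeroVectors (l ⊓ LinearMap.ker f)) + 1 = Fintype.card F ∨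
      #(nonzeroVectors (l ⊓ LinearMap.ker f)) + 1 = Fintype.card F ^ 2 := by
  have h1 : finrank F (l ⊓ LinearMap.ker f : Submodule F V) ≤ 2 :=
    hl ▸ Submodule.finrank_mono inf_le_left
  have h2 := Submodule.finrank_sup_add_finrank_inf_eq l (LinearMap.ker f)
  have h3 := f.finrank_range_add_finrank_ker
  have h4 : finrank F (LinearMap.range f) ≤ 1 := by
    simpa using Submodule.finrank_le (LinearMap.range f)
  have h5 := Submodule.finrank_le (l ⊔ LinearMap.ker f)
  rw [card_nonzeroVectors_add_one]
  have : finrank F (l ⊓ LinearMap.ker f : Submodule F V) = 1 ∨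
    finrank F (l ⊓ LinearMap.ker f : Submodule F V) = 2 := by omega
  rcases this with h | h <;> simp [h]

variable [Fintype (Dual F V)]

lemma card_annihilating_mul (W : Submodule F V) :
    #(annihilating W) * Fintype.card F ^ finrank F W = Fintype.card F ^ finrank F V := by
  have h := Subspace.finrank_add_finrank_dualAnnihilator_eq W
  have h' : #(annihilating W) = Fintype.card F ^ finrank F W.dualAnnihilator := by
    rw [← Module.card_eq_pow_finrank (K := F) (V := W.dualAnnihilator), Fintype.card_subtype]
    rfl
  rw [h', ← pow_add, add_comm, h]

lemma card_mul_card_annihilating_sup_span {W : Submodule F V} {v : V} (hv : v ∉ W) :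
    Fintype.card F * #(annihilating (W ⊔ Submodule.span F {v})) = #(annihilating W) := by
  have h1 := card_annihilating_mul W
  have h2 := card_annihilating_mul (W ⊔ Submodule.span F {v})
  rw [Submodule.finrank_sup_span_singleton hv] at h2
  have h3 : 0 < Fintype.card F ^ finrank F W := pow_pos Fintype.card_pos _
  refine Nat.eq_of_mul_eq_mul_right h3 ?_
  rw [h1, ← h2]
  ring

/-- The first moment of the number of holes in hyperplanes through `W`. -/
lemma sum_card_holesIn_ker (hq : Fintype.card F = 4) (S : Finset (Submodule F V))
    (W : Submodule F V) :
    4 * ∑ f ∈ annihilating W, #(holesIn S (LinearMap.ker f)) =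
      #(annihilating W) * (#(holes S) + 3 * #(holesIn S W)) := by
  have h1 : ∑ f ∈ annihilating W, #(holesIn S (LinearMap.ker f)) =
      ∑ v ∈ holes S, #(annihilating (W ⊔ Submodule.span F {v})) := by
    simp_rw [← annihilating_sup_span, holesIn]
    exact Finset.sum_card_bipartiteAbove_eq_sum_card_bipartiteBelow
      (r := fun (f : Dual F V) (v : V) => v ∈ LinearMap.ker f)
  have h2 : ∀ v ∈ holes S, 4 * #(annihilating (W ⊔ Submodule.span F {v})) =
      #(annihilating W) * (1 + 3 * if v ∈ W then 1 else 0) := by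
    intro v _
    split_ifs with hv
    · rw [sup_eq_left.2 (by simpa using hv)]
      ring
    · rw [← hq, card_mul_card_annihilating_sup_span hv]
      ring
  rw [h1, Finset.mul_sum, Finset.sum_congr rfl h2, ← Finset.mul_sum, Finset.sum_add_distrib,
    ← Finset.mul_sum]
  simp [holesIn, Finset.sum_boole]

end Holes

section UpperBound

open Module Finset
open scoped Classical

variable {F V : Type*} [Field F] [Fintype F] [AddCommGroup V] [Module F V] [Fintype V]
  {S : Finset (Submodule F V)}

lemma card_holes_add (hq : Fintype.card F = 4) (hV : finrank F V = 6)
    (h2 : ∀ l ∈ S, finrank F l = 2) (hS : ∀ l ∈ S, ∀ l' ∈ S, l ≠ l' → l ⊓ l' = ⊥) :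
    #(holes S) + 15 * #S = 4095 := by
  have h := card_holesIn_add_sum S hS ⊤
  have ht := card_nonzeroVectors_add_one (⊤ : Submodule F V)
  rw [finrank_top, hV, hq] at ht
  have hl : ∀ l ∈ S, #(nonzeroVectors (l ⊓ ⊤)) = 15 := by
    intro l hl
    have := card_nonzeroVectors_add_one l
    rw [h2 l hl, hq] at this
    rw [inf_top_eq]
    omega
  rw [Finset.sum_congr rfl hl, holesIn_top, Finset.sum_const, smul_eq_mul] at h
  omega

/-- The number of holes in a hyperplane, modulo 12. -/
lemma card_holesIn_ker_modEq (hq : Fintype.card F = 4) (hV : finrank F V = 6)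
    (h2 : ∀ l ∈ S, finrank F l = 2) (hS : ∀ l ∈ S, ∀ l' ∈ S, l ≠ l' → l ⊓ l' = ⊥)
    (f : Dual F V) :
    #(holesIn S (LinearMap.ker f)) + 3 * #S ≡ 3 [MOD 12] := by
  have h := card_holesIn_add_sum S hS (LinearMap.ker f)
  have hk := card_nonzeroVectors_add_one (LinearMap.ker f)
  have hk' : #(nonzeroVectors (LinearMap.ker f)) ≡ 3 [MOD 12] := by
    have h3 := f.finrank_range_add_finrank_ker
    have h4 : finrank F (LinearMap.range f) ≤ 1 := by
      simpa using Submodule.finrank_le (LinearMap.range f)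
    have : finrank F (LinearMap.ker f) = 5 ∨ finrank F (LinearMap.ker f) = 6 := by omega
    rw [hq] at hk
    rw [Nat.ModEq]
    rcases this with h | h <;> rw [h] at hk <;> omega
  have hs : ∑ l ∈ S, #(nonzeroVectors (l ⊓ LinearMap.ker f)) ≡ ∑ l ∈ S, 3 [MOD 12] := by
    refine Nat.ModEq.sum fun l hl => ?_
    have := card_nonzeroVectors_inf_ker (h2 l hl) f
    rw [hq] at this
    rw [Nat.ModEq]
    omega
  rw [Finset.sum_const, smul_eq_mul] at hs
  rw [Nat.ModEq] at *
  omega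

lemma card_holesIn_line_le (hq : Fintype.card F = 4)
    (hS : ∀ l ∈ S, ∀ l' ∈ S, l ≠ l' → l ⊓ l' = ⊥)
    (hmax : ∀ m : Submodule F V, finrank F m = 2 → ∃ l ∈ S, m ⊓ l ≠ ⊥)
    {m : Submodule F V} (hm : finrank F m = 2) : #(holesIn S m) ≤ 12 := by
  obtain ⟨l, hl, hml⟩ := hmax m hm
  have h := card_holesIn_add_sum S hS m
  have h1 := card_nonzeroVectors_add_one m
  have h2 := card_nonzeroVectors_add_one (l ⊓ m)
  have h3 : 1 ≤ finrank F (l ⊓ m : Submodule F V) :=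
    Submodule.one_le_finrank_iff.2 (by rwa [inf_comm])
  have h4 := Nat.pow_le_pow_right (n := 4) (by norm_num) h3
  have h5 := Finset.single_le_sum (f := fun l => #(nonzeroVectors (l ⊓ m)))
    (fun _ _ => Nat.zero_le _) hl
  rw [hq] at h1 h2
  rw [hm] at h1
  omega

lemma exists_mem_holes_notMem (hq : Fintype.card F = 4) (h : 3 < #(holes S)) {p : V}
    (hp : p ∈ holes S) : ∃ u ∈ holes S, u ∉ Submodule.span F {p} := by
  by_contra! hc
  have hp0 : p ≠ 0 := by
    simp only [holes, mem_filter] at hp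
    exact hp.2.1
  have h1 : holesIn S (Submodule.span F {p}) = holes S := Finset.filter_true_of_mem hc
  have h2 := card_nonzeroVectors_add_one (Submodule.span F {p})
  rw [← holesIn_span_singleton hp, h1, finrank_span_singleton hp0, hq] at h2
  omega

lemma card_holesIn_span_singleton (hq : Fintype.card F = 4) {p : V} (hp : p ∈ holes S) :
    #(holesIn S (Submodule.span F {p})) = 3 := by
  have hp0 : p ≠ 0 := by
    simp only [holes, mem_filter] at hp
    exact hp.2.1
  have h2 := card_nonzeroVectors_add_one (Submodule.span F {p})
  rw [← holesIn_span_singleton hp, finrank_span_singleton hp0, hq] at h2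
  omega

variable [Fintype (Dual F V)]

lemma card_annihilating_of_finrank (hq : Fintype.card F = 4) (hV : finrank F V = 6)
    {W : Submodule F V} {k : ℕ} (hW : finrank F W = k) :
    #(annihilating W) * 4 ^ k = 4096 := by
  have h := card_annihilating_mul W
  rw [hq, hV, hW] at h
  exact h

/-- If every hyperplane through a line contains many holes, then so does the line. -/
lemma le_card_holes_add_card_holesIn (hq : Fintype.card F = 4) (hV : finrank F V = 6)
    {m : Submodule F V} (hm : finrank F m = 2) {k : ℕ}
    (hk : ∀ f ∈ annihilating m, k ≤ #(holesIn S (LinearMap.ker f))) :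
    4 * k ≤ #(holes S) + 3 * #(holesIn S m) := by
  have h1 := sum_card_holesIn_ker hq S m
  have h2 := card_annihilating_of_finrank hq hV hm
  have h3 := Finset.card_nsmul_le_sum _ _ _ hk
  rw [smul_eq_mul] at h3
  have h4 : #(annihilating m) = 256 := by omega
  rw [h4] at h1 h3
  omega

lemma card_ne_272 (hq : Fintype.card F = 4) (hV : finrank F V = 6)
    (h2 : ∀ l ∈ S, finrank F l = 2) (hS : ∀ l ∈ S, ∀ l' ∈ S, l ≠ l' → l ⊓ l' = ⊥)
    (hmax : ∀ m : Submodule F V, finrank F m = 2 → ∃ l ∈ S, m ⊓ l ≠ ⊥) : #S ≠ 272 := by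
  intro hc
  have hU := card_holes_add hq hV h2 hS
  obtain ⟨p, hp⟩ : (holes S).Nonempty := Finset.card_pos.1 (by omega)
  obtain ⟨u, hu, hup⟩ := exists_mem_holes_notMem hq (by omega) hp
  have hm := finrank_span_sup_span hp hup
  have hle := card_holesIn_line_le hq hS hmax hm
  have h4 : #(holesIn S (Submodule.span F {p})) <
      #(holesIn S (Submodule.span F {p} ⊔ Submodule.span F {u})) := by
    refine Finset.card_lt_card ⟨holesIn_mono S le_sup_left, fun h => hup ?_⟩
    have : u ∈ holesIn S (Submodule.span F {p}) :=
      h (mem_filter.2 ⟨hu, Submodule.mem_sup_right (Submodule.mem_span_singleton_self u)⟩)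
    exact (mem_filter.1 this).2
  rw [card_holesIn_span_singleton hq hp] at h4
  have := le_card_holes_add_card_holesIn (S := S) hq hV hm (k := 15) fun f hf => by
    have h5 := Finset.card_le_card (holesIn_mono S (mem_annihilating.1 hf))
    have h6 := card_holesIn_ker_modEq hq hV h2 hS f
    rw [Nat.ModEq] at h6
    omega
  omega

/-- If there are 30 hole vectors, then some line contains at least seven of them. -/
lemma exists_seven_le_card_holesIn (hq : Fintype.card F = 4) (hV : finrank F V = 6)
    (h2 : ∀ l ∈ S, finrank F l = 2) (hS : ∀ l ∈ S, ∀ l' ∈ S, l ≠ l' → l ⊓ l' = ⊥)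
    (hc : #S = 271) {p : V} (hp : p ∈ holes S) :
    ∃ u ∈ holes S, u ∉ Submodule.span F {p} ∧
      7 ≤ #(holesIn S (Submodule.span F {p} ⊔ Submodule.span F {u})) := by
  by_contra! hlt
  have hU := card_holes_add hq hV h2 hS
  have hU' : #(holes S) = 30 := by omega
  have hP := card_holesIn_span_singleton hq hp
  have hp0 : p ≠ 0 := by
    simp only [holes, mem_filter] at hp
    exact hp.2.1
  have hA := card_annihilating_of_finrank hq hV (finrank_span_singleton (K := F) hp0)
  have hA' : #(annihilating (Submodule.span F {p})) = 1024 := by omega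
  have h1 := sum_card_holesIn_ker hq S (Submodule.span F {p})
  rw [hA', hU', hP] at h1
  have hsq : ∑ f ∈ annihilating (Submodule.span F {p}), #(holesIn S (LinearMap.ker f)) ^ 2 ≤
      112896 := by
    rw [sum_card_holesIn_ker_sq]
    have hb : ∀ u ∈ holes S, ∑ f ∈ annihilating (Submodule.span F {p} ⊔ Submodule.span F {u}),
        #(holesIn S (LinearMap.ker f)) ≤
          3072 + 6912 * if u ∈ Submodule.span F {p} then 1 else 0 := by
      intro u hu
      split_ifs with hup
      · rw [sup_eq_left.2 (by simpa using hup)]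
        omega
      · have h3 := sum_card_holesIn_ker hq S (Submodule.span F {p} ⊔ Submodule.span F {u})
        have h4 := card_annihilating_of_finrank hq hV (finrank_span_sup_span hp hup)
        have h5 := hlt u hu hup
        rw [hU', show #(annihilating (Submodule.span F {p} ⊔ Submodule.span F {u})) = 256 by
          omega] at h3
        omega
    refine (Finset.sum_le_sum hb).trans ?_
    rw [Finset.sum_add_distrib, ← Finset.mul_sum, Finset.sum_boole, Finset.sum_const, hU']
    change _ + 6912 * #(holesIn S (Submodule.span F {p})) ≤ _
    rw [hP]
    norm_num
  have hpos : ∀ f ∈ annihilating (Submodule.span F {p}),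
      24 * #(holesIn S (LinearMap.ker f)) ≤ #(holesIn S (LinearMap.ker f)) ^ 2 + 108 := by
    intro f _
    have h6 := card_holesIn_ker_modEq hq hV h2 hS f
    rw [hc, Nat.ModEq] at h6
    generalize #(holesIn S (LinearMap.ker f)) = z at h6 ⊢
    have : z = 6 ∨ 18 ≤ z := by omega
    rcases this with rfl | h
    · norm_num
    · nlinarith
  have := Finset.sum_le_sum hpos
  rw [← Finset.mul_sum, Finset.sum_add_distrib, Finset.sum_const, hA'] at this
  simp only [smul_eq_mul] at this
  omega

lemma card_ne_271 (hq : Fintype.card F = 4) (hV : finrank F V = 6)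
    (h2 : ∀ l ∈ S, finrank F l = 2) (hS : ∀ l ∈ S, ∀ l' ∈ S, l ≠ l' → l ⊓ l' = ⊥)
    (hmax : ∀ m : Submodule F V, finrank F m = 2 → ∃ l ∈ S, m ⊓ l ≠ ⊥) : #S ≠ 271 := by
  intro hc
  have hU := card_holes_add hq hV h2 hS
  obtain ⟨p, hp⟩ : (holes S).Nonempty := Finset.card_pos.1 (by omega)
  obtain ⟨u, hu, hup, h7⟩ := exists_seven_le_card_holesIn hq hV h2 hS hc hp
  have hm := finrank_span_sup_span hp hup
  have hle := card_holesIn_line_le hq hS hmax hm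
  have := le_card_holes_add_card_holesIn (S := S) hq hV hm (k := 18) fun f hf => by
    have h5 := Finset.card_le_card (holesIn_mono S (mem_annihilating.1 hf))
    have h6 := card_holesIn_ker_modEq hq hV h2 hS f
    rw [Nat.ModEq] at h6
    omega
  omega

end UpperBound

/-- A maximal partial line spread of PG(5,4) with more than 270 lines is a spread. -/
theorem ncard_eq_of_isMaximalPartialLineSpread {F : Type*} [Field F] [Fintype F]
    (hq : Fintype.card F = 4) {S : Set (Submodule F (Fin 6 → F))}
    (hS : IsMaximalPartialLineSpread F 6 S) (hlt : 270 < S.ncard) : S.ncard = 273 := by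
  classical
  have hfin : S.Finite := Set.finite_of_ncard_pos (by omega)
  lift S to Finset (Submodule F (Fin 6 → F)) using hfin
  rw [Set.ncard_coe_finset] at hlt ⊢
  obtain ⟨⟨h2, hd⟩, hmax⟩ := hS
  have hV : Module.finrank F (Fin 6 → F) = 6 := by simp
  have : Finite (Module.Dual F (Fin 6 → F)) := Module.finite_of_finite F
  have : Fintype (Module.Dual F (Fin 6 → F)) := Fintype.ofFinite _
  simp only [Finset.mem_coe] at h2 hd hmax
  have h := card_holes_add hq hV h2 hd
  have h271 := card_ne_271 hq hV h2 hd hmax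
  have h272 := card_ne_272 hq hV h2 hd hmax
  omega

section QuaternaryTables

/-- Addition of GF(4) on the labels `0, 1, 2, 3` of `0, 1, ω, ω + 1`. -/
def quatAdd (a b : Fin 4) : Fin 4 :=
  !![0, 1, 2, 3; 1, 0, 3, 2; 2, 3, 0, 1; 3, 2, 1, 0] a b

/-- Multiplication of GF(4) on the labels `0, 1, 2, 3` of `0, 1, ω, ω + 1`. -/
def quatMul (a b : Fin 4) : Fin 4 :=
  !![0, 0, 0, 0; 0, 1, 2, 3; 0, 2, 3, 1; 0, 3, 1, 2] a b

/-- The determinant of the difference of two 2 × 2 matrices over GF(4), given by labels. -/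
def quatDetSub (M N : Matrix (Fin 2) (Fin 2) (Fin 4)) : Fin 4 :=
  quatAdd (quatMul (quatAdd (M 0 0) (N 0 0)) (quatAdd (M 1 1) (N 1 1)))
    (quatMul (quatAdd (M 0 1) (N 0 1)) (quatAdd (M 1 0) (N 1 0)))

/-- A maximal set of 2 × 2 matrices over GF(4) with pairwise invertible differences. -/
def spreadSet : Fin 13 → Matrix (Fin 2) (Fin 2) (Fin 4) :=
  ![!![0, 0; 0, 0], !![0, 3; 3, 3], !![3, 3; 3, 0], !![1, 1; 3, 1], !![2, 2; 3, 2],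
    !![1, 3; 1, 2], !![3, 2; 1, 1], !![0, 1; 1, 3], !![2, 1; 1, 0], !![2, 3; 2, 1],
    !![3, 1; 2, 2], !![1, 2; 2, 0], !![0, 2; 2, 3]]

lemma quatDetSub_spreadSet_ne_zero :
    ∀ i j, i ≠ j → quatDetSub (spreadSet i) (spreadSet j) ≠ 0 := by
  decide +kernel

lemma exists_quatDetSub_spreadSet_eq_zero :
    ∀ a b c d : Fin 4, ∃ i, quatDetSub !![a, b; c, d] (spreadSet i) = 0 := by
  decide +kernel

end QuaternaryTables

section FourElements

variable {F : Type*} [Field F]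

/-- The element of GF(4) with a given label. -/
def quatVal (w : F) : Fin 4 → F := ![0, 1, w, w + 1]

variable {w : F}

lemma quatVal_add (h2 : (2 : F) = 0) (a b : Fin 4) :
    quatVal w (quatAdd a b) = quatVal w a + quatVal w b := by
  fin_cases a <;> fin_cases b <;> simp [quatVal, quatAdd] <;> grind

lemma quatVal_mul (h2 : (2 : F) = 0) (hw : w ^ 2 + w + 1 = 0) (a b : Fin 4) :
    quatVal w (quatMul a b) = quatVal w a * quatVal w b := by
  fin_cases a <;> fin_cases b <;> simp [quatVal, quatMul] <;> grind

lemma quatVal_injective (h2 : (2 : F) = 0) (hw : w ^ 2 + w + 1 = 0) :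
    Function.Injective (quatVal w) := by
  have h0 : w ≠ 0 := by grind
  have h1 : w ≠ 1 := by grind
  have h3 : w + 1 ≠ 0 := by grind
  intro a b
  fin_cases a <;> fin_cases b <;> simp [quatVal] <;> grind

lemma quatVal_surjective [Fintype F] (hq : Fintype.card F = 4) (h2 : (2 : F) = 0)
    (hw : w ^ 2 + w + 1 = 0) : Function.Surjective (quatVal w) :=
  ((Fintype.bijective_iff_injective_and_card _).2
    ⟨quatVal_injective h2 hw, by simp [hq]⟩).2

lemma det_sub_map_quatVal (h2 : (2 : F) = 0) (hw : w ^ 2 + w + 1 = 0)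
    (M N : Matrix (Fin 2) (Fin 2) (Fin 4)) :
    (M.map (quatVal w) - N.map (quatVal w)).det = quatVal w (quatDetSub M N) := by
  simp only [quatDetSub, quatVal_add h2, quatVal_mul h2 hw, Matrix.det_fin_two, Matrix.sub_apply,
    Matrix.map_apply]
  grind

lemma two_eq_zero_of_card [Fintype F] (hq : Fintype.card F = 4) : (2 : F) = 0 := by
  have h := Nat.cast_card_eq_zero F
  rw [hq] at h
  have : (2 : F) * 2 = 0 := by
    rw [← h]
    norm_num
  simpa using this

lemma exists_sq_add_self_add_one [Fintype F] (hq : Fintype.card F = 4) :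
    ∃ w : F, w ^ 2 + w + 1 = 0 := by
  classical
  obtain ⟨w, -, hw⟩ := Finset.exists_mem_notMem_of_card_lt_card (s := ({0, 1} : Finset F))
    (t := Finset.univ) (by
      rw [Finset.card_univ, hq]
      exact Finset.card_le_two.trans_lt (by norm_num))
  simp only [Finset.mem_insert, Finset.mem_singleton, not_or] at hw
  refine ⟨w, ?_⟩
  have h3 := FiniteField.pow_card_sub_one_eq_one w hw.1
  rw [hq] at h3
  have : (w - 1) * (w ^ 2 + w + 1) = 0 := by linear_combination h3
  exact (mul_eq_zero.1 this).resolve_left (sub_ne_zero.2 hw.2)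

/-- The quadratic form `x² + xy + ωy²` is anisotropic over GF(4). -/
lemma norm_form_ne_zero [Fintype F] (hq : Fintype.card F = 4) (hw : w ^ 2 + w + 1 = 0)
    {x y : F} (h : x ≠ 0 ∨ y ≠ 0) : x ^ 2 + x * y + w * y ^ 2 ≠ 0 := by
  have h2 := two_eq_zero_of_card hq
  intro h0
  by_cases hy0 : y = 0
  · subst hy0
    simp_all
  · have ht := FiniteField.pow_card (x / y)
    rw [hq] at ht
    have h1 : (x / y) ^ 2 + x / y + w = 0 := by
      field_simp
      linear_combination h0
    generalize x / y = t at ht h1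
    grind

end FourElements

section Construction

open Matrix

variable {F : Type*} [Field F]

/-- The map `x ↦ (A x, B x, C x)` from `F²` to `F⁶ = F² ⊕ F² ⊕ F²`. -/
def blockMap (A B C : Matrix (Fin 2) (Fin 2) F) : (Fin 2 → F) →ₗ[F] (Fin 6 → F) where
  toFun x := ![(A *ᵥ x) 0, (A *ᵥ x) 1, (B *ᵥ x) 0, (B *ᵥ x) 1, (C *ᵥ x) 0, (C *ᵥ x) 1]
  map_add' x y := by
    ext i
    fin_cases i <;> simp [mulVec_add]
  map_smul' c x := by
    ext i
    fin_cases i <;> simp [mulVec_smul]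

/-- Multiplication by `a₀ + a₁θ` in GF(16) = GF(4)(θ), where `θ² = θ + ω`. -/
def fieldMat (w : F) (a : F × F) : Matrix (Fin 2) (Fin 2) F :=
  !![a.1, w * a.2; a.2, a.1 + a.2]

/-- Parametrizations of the lines of a maximal partial line spread: 256 lines skew to the solid
`0 ⊕ F² ⊕ F²`, and 14 lines forming a maximal partial spread of that solid. -/
def spreadMap (w : F) : ((F × F) × (F × F)) ⊕ Option (Fin 13) → (Fin 2 → F) →ₗ[F] (Fin 6 → F)
  | .inl (a, b) => blockMap 1 (fieldMat w a) (fieldMat w b)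
  | .inr (some i) => blockMap 0 1 ((spreadSet i).map (quatVal w))
  | .inr none => blockMap 0 0 1

lemma eq_zero_of_blockMap_eq_zero {A B C : Matrix (Fin 2) (Fin 2) F} {x : Fin 2 → F}
    (hABC : A = 1 ∨ B = 1 ∨ C = 1) (h : blockMap A B C x = 0) : x = 0 := by
  have h' : ∀ i, blockMap A B C x i = 0 := fun i => congrFun h i
  have h0 := h' 0
  have h1 := h' 1
  have h2 := h' 2
  have h3 := h' 3
  have h4 := h' 4
  have h5 := h' 5
  simp only [blockMap, LinearMap.coe_mk, AddHom.coe_mk, cons_val] at h0 h1 h2 h3 h4 h5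
  ext i
  rcases hABC with rfl | rfl | rfl <;> simp only [one_mulVec] at * <;> fin_cases i <;> assumption

lemma spreadMap_injective (w : F) (i : ((F × F) × (F × F)) ⊕ Option (Fin 13)) :
    Function.Injective (spreadMap w i) := by
  rw [← LinearMap.ker_eq_bot, LinearMap.ker_eq_bot']
  intro x hx
  rcases i with ⟨a, b⟩ | _ | i <;> exact eq_zero_of_blockMap_eq_zero (by simp) hx

lemma blockMap_eq_iff {A B C A' B' C' : Matrix (Fin 2) (Fin 2) F} {x y : Fin 2 → F} :
    blockMap A B C x = blockMap A' B' C' y ↔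
      A *ᵥ x = A' *ᵥ y ∧ B *ᵥ x = B' *ᵥ y ∧ C *ᵥ x = C' *ᵥ y := by
  constructor
  · intro h
    have h' : ∀ i, blockMap A B C x i = blockMap A' B' C' y i := fun i => congrFun h i
    refine ⟨?_, ?_, ?_⟩ <;> ext i <;> fin_cases i
    exacts [h' 0, h' 1, h' 2, h' 3, h' 4, h' 5]
  · rintro ⟨h1, h2, h3⟩
    simp only [blockMap, LinearMap.coe_mk, AddHom.coe_mk, h1, h2, h3]

variable [Fintype F] {w : F}

lemma fieldMat_mulVec_injective (hq : Fintype.card F = 4) (hw : w ^ 2 + w + 1 = 0) {a b : F × F}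
    {x : Fin 2 → F} (hx : x ≠ 0) (h : fieldMat w a *ᵥ x = fieldMat w b *ᵥ x) : a = b := by
  have hx' : x 0 ≠ 0 ∨ x 1 ≠ 0 := by
    by_contra! hc
    exact hx (by ext i; fin_cases i <;> simp [hc])
  have hn := norm_form_ne_zero hq hw hx'
  have h0 := congrFun h 0
  have h1 := congrFun h 1
  simp only [fieldMat, mulVec, dotProduct, Fin.sum_univ_two, of_apply, cons_val] at h0 h1
  have h2 := two_eq_zero_of_card hq
  refine Prod.ext ?_ ?_
  · refine sub_eq_zero.1 ((mul_eq_zero.1 ?_).resolve_right hn)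
    grind
  · refine sub_eq_zero.1 ((mul_eq_zero.1 ?_).resolve_right hn)
    grind

lemma exists_fieldMat_mulVec_eq (hq : Fintype.card F = 4) (hw : w ^ 2 + w + 1 = 0)
    {x : Fin 2 → F} (hx : x ≠ 0) (y : Fin 2 → F) : ∃ a, fieldMat w a *ᵥ x = y := by
  have hinj : Function.Injective fun a => fieldMat w a *ᵥ x :=
    fun a b h => fieldMat_mulVec_injective hq hw hx h
  exact ((Fintype.bijective_iff_injective_and_card _).2 ⟨hinj, by simp [sq]⟩).2 y

lemma spreadMap_range_disjoint (hq : Fintype.card F = 4) (hw : w ^ 2 + w + 1 = 0)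
    {i j : ((F × F) × (F × F)) ⊕ Option (Fin 13)} (hij : i ≠ j) :
    LinearMap.range (spreadMap w i) ⊓ LinearMap.range (spreadMap w j) = ⊥ := by
  have h2 := two_eq_zero_of_card hq
  rw [eq_bot_iff]
  rintro _ ⟨⟨x, rfl⟩, y, hxy⟩
  rw [Submodule.mem_bot]
  suffices x = 0 by simp [this]
  by_contra hx
  rcases i with ⟨a, b⟩ | _ | i <;> rcases j with ⟨a', b'⟩ | _ | j <;>
    simp only [spreadMap, blockMap_eq_iff, one_mulVec, zero_mulVec] at hxy
  · obtain ⟨rfl, ha, hb⟩ := hxy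
    exact hij (by rw [fieldMat_mulVec_injective hq hw hx ha, fieldMat_mulVec_injective hq hw hx hb])
  · exact hx hxy.1.symm
  · exact hx hxy.1.symm
  · obtain ⟨rfl, -, h⟩ := hxy
    exact hx (by simpa using h.symm)
  · exact hij rfl
  · obtain ⟨-, rfl, h⟩ := hxy
    exact hx (by simpa using h.symm)
  · obtain ⟨rfl, h, -⟩ := hxy
    exact hx (by simpa using h.symm)
  · exact hx hxy.2.1.symm
  · obtain ⟨-, rfl, h⟩ := hxy
    have hne : i ≠ j := by
      rintro rfl
      exact hij rfl
    have hdet : ((spreadSet i).map (quatVal w) - (spreadSet j).map (quatVal w)).det ≠ 0 := by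
      rw [det_sub_map_quatVal h2 hw]
      exact fun h => quatDetSub_spreadSet_ne_zero i j hne
        (quatVal_injective h2 hw (h.trans (by simp [quatVal])))
    exact hdet (exists_mulVec_eq_zero_iff.1 ⟨y, hx, by rw [sub_mulVec, h, sub_self]⟩)

lemma exists_meet_spreadMap (hq : Fintype.card F = 4) (hw : w ^ 2 + w + 1 = 0)
    {m : Submodule F (Fin 6 → F)} (hm : Module.finrank F m = 2) :
    ∃ i, m ⊓ LinearMap.range (spreadMap w i) ≠ ⊥ := by
  have h2 := two_eq_zero_of_card hq
  by_contra! hc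
  have hz : ∀ v ∈ m, ∀ i x, spreadMap w i x = v → v = 0 := by
    intro v hv i x hx
    have : v ∈ m ⊓ LinearMap.range (spreadMap w i) := ⟨hv, x, hx⟩
    rwa [hc, Submodule.mem_bot] at this
  have hsplit : ∀ v : Fin 6 → F, v = ![v 0, v 1, v 2, v 3, v 4, v 5] := by
    intro v
    ext i
    fin_cases i <;> rfl
  have hfst : ∀ v ∈ m, v 0 = 0 ∧ v 1 = 0 := by
    intro v hv
    by_cases hx : ![v 0, v 1] = 0
    · exact ⟨congrFun hx 0, congrFun hx 1⟩
    · obtain ⟨a, ha⟩ := exists_fieldMat_mulVec_eq hq hw hx ![v 2, v 3]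
      obtain ⟨b, hb⟩ := exists_fieldMat_mulVec_eq hq hw hx ![v 4, v 5]
      have := hz v hv (.inl (a, b)) ![v 0, v 1] (by
        rw [hsplit v]
        simp only [spreadMap, blockMap, LinearMap.coe_mk, AddHom.coe_mk, one_mulVec, cons_val,
          ha, hb])
      simp [this]
  let π : m →ₗ[F] (Fin 2 → F) :=
    (LinearMap.funLeft F F ![(2 : Fin 6), 3]).comp m.subtype
  have hπ : ∀ v : m, ∀ i, π v i = v.1 (![(2 : Fin 6), 3] i) := fun _ _ => rfl
  have hinj : Function.Injective π := by
    rw [← LinearMap.ker_eq_bot, LinearMap.ker_eq_bot']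
    rintro ⟨v, hv⟩ h
    have h3 : v 2 = 0 := congrFun h 0
    have h4 : v 3 = 0 := congrFun h 1
    have := hz v hv (.inr none) ![v 4, v 5] (by
      rw [hsplit v, (hfst v hv).1, (hfst v hv).2, h3, h4]
      simp [spreadMap, blockMap])
    simpa using this
  have hsurj : Function.Surjective π :=
    (LinearMap.injective_iff_surjective_of_finrank_eq_finrank (by simp [hm])).1 hinj
  obtain ⟨⟨s, hs⟩, hs'⟩ := hsurj ![1, 0]
  obtain ⟨⟨t, ht⟩, ht'⟩ := hsurj ![0, 1]
  have hs2 : s 2 = 1 := congrFun hs' 0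
  have hs3 : s 3 = 0 := congrFun hs' 1
  have ht2 : t 2 = 0 := congrFun ht' 0
  have ht3 : t 3 = 1 := congrFun ht' 1
  obtain ⟨a, ha⟩ := quatVal_surjective hq h2 hw (s 4)
  obtain ⟨b, hb⟩ := quatVal_surjective hq h2 hw (t 4)
  obtain ⟨c, hc'⟩ := quatVal_surjective hq h2 hw (s 5)
  obtain ⟨d, hd⟩ := quatVal_surjective hq h2 hw (t 5)
  obtain ⟨i, hi⟩ := exists_quatDetSub_spreadSet_eq_zero a b c d
  have hdet := det_sub_map_quatVal h2 hw !![a, b; c, d] (spreadSet i)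
  rw [hi] at hdet
  obtain ⟨x, hx, hx'⟩ := exists_mulVec_eq_zero_iff.2 (hdet.trans (by simp [quatVal]))
  rw [sub_mulVec, sub_eq_zero] at hx'
  have hv := hz (x 0 • s + x 1 • t) (m.add_mem (m.smul_mem _ hs) (m.smul_mem _ ht))
    (.inr (some i)) x (by
      simp only [spreadMap, blockMap, LinearMap.coe_mk, AddHom.coe_mk, ← hx']
      rw [hsplit s, hsplit t, (hfst s hs).1, (hfst s hs).2, (hfst t ht).1, (hfst t ht).2,
        hs2, hs3, ht2, ht3, ← ha, ← hb, ← hc', ← hd]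
      ext k
      fin_cases k <;> simp [mulVec, dotProduct, Fin.sum_univ_two, mul_comm])
  refine hx ?_
  have hv2 := congrFun hv 2
  have hv3 := congrFun hv 3
  simp only [Pi.add_apply, Pi.smul_apply, Pi.zero_apply, hs2, hs3, ht2, ht3, smul_eq_mul, mul_one,
    mul_zero, add_zero, zero_add] at hv2 hv3
  ext k
  fin_cases k
  exacts [hv2, hv3]

/-- PG(5,4) has a maximal partial line spread with 270 lines. -/
theorem exists_isMaximalPartialLineSpread_ncard_eq (hq : Fintype.card F = 4) :
    ∃ S : Set (Submodule F (Fin 6 → F)), IsMaximalPartialLineSpread F 6 S ∧ S.ncard = 270 := by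
  obtain ⟨w, hw⟩ := exists_sq_add_self_add_one hq
  have hrank : ∀ i, Module.finrank F (LinearMap.range (spreadMap w i)) = 2 := by
    intro i
    rw [LinearMap.finrank_range_of_inj (spreadMap_injective w i)]
    simp
  have hinj : Function.Injective fun i => LinearMap.range (spreadMap w i) := by
    intro i j hij
    by_contra hne
    have h := spreadMap_range_disjoint hq hw hne
    simp only at hij
    rw [← hij, inf_idem] at h
    have h' := hrank i
    rw [h, finrank_bot] at h'
    omega
  refine ⟨Set.range fun i => LinearMap.range (spreadMap w i), ⟨⟨?_, ?_⟩, ?_⟩, ?_⟩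
  · rintro _ ⟨i, rfl⟩
    exact hrank i
  · rintro _ ⟨i, rfl⟩ _ ⟨j, rfl⟩ hij
    exact spreadMap_range_disjoint hq hw fun h => hij (by rw [h])
  · intro m hm
    obtain ⟨i, hi⟩ := exists_meet_spreadMap hq hw hm
    exact ⟨_, ⟨i, rfl⟩, hi⟩
  · rw [Set.ncard_range_of_injective hinj]
    simp [Nat.card_eq_fintype_card, hq]

end Construction

/-- In PG(5,4), the largest maximal partial line spread that is not a spread
has size 270: there is a maximal partial line spread of size 270, and every
maximal partial line spread of size greater than 270 has size 273 (a spread). -/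
theorem stmt8 (F : Type*) [Field F] [Fintype F] (hq : Fintype.card F = 4) :
    (∃ S : Set (Submodule F (Fin 6 → F)),
      IsMaximalPartialLineSpread F 6 S ∧ S.ncard = 270) ∧
    (∀ S : Set (Submodule F (Fin 6 → F)),
      IsMaximalPartialLineSpread F 6 S → 270 < S.ncard → S.ncard = 273) := by
  exact ⟨exists_isMaximalPartialLineSpread_ncard_eq hq, fun S hS hlt =>
    ncard_eq_of_isMaximalPartialLineSpread hq hS hlt⟩
end

section
/- In PG(5,3), there exist maximal partial line spreads of size 37 + 3k for every integer k with 0 ≤ k ≤ 7, of every size n with 60 ≤ n ≤ 88, and of size 91 (a spread). -/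
namespace LineSpread

section Codes

/-- Base `6` code of a digit vector; sums of two vectors with digits below `3` produce no carry. -/
def code (d : ℕ → ℕ) : ℕ :=
  d 0 + 6 * d 1 + 36 * d 2 + 216 * d 3 + 1296 * d 4 + 7776 * d 5

/-- A natural number `c` encodes two vectors of `GF(3)^6` by its ternary digits `0, …, 5` and
`6, …, 11`; these are the digits of the combination with coefficients `i` and `j`. -/
def combDigits (i j c k : ℕ) : ℕ :=
  (i * (c / 3 ^ k) + j * (c / 3 ^ (k + 6))) % 3

/-- Codes of the nonzero vectors of the line encoded by `c`. -/
def pointCodes (c : ℕ) : List ℕ :=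
  [(0, 1), (0, 2), (1, 0), (1, 1), (1, 2), (2, 0), (2, 1), (2, 2)].map
    fun ij : ℕ × ℕ => code (combDigits ij.1 ij.2 c)

/-- The number whose binary digits equal to `1` are at the positions listed in `l`. -/
def bitMask (l : List ℕ) : ℕ :=
  l.foldr (fun c M => 1 <<< c ||| M) 0

/-- Positions in `l` are pairwise distinct and not set in `M`. -/
def freshPositions : ℕ → List ℕ → Bool
  | _, [] => true
  | M, c :: l => !M.testBit c && freshPositions (M ||| 1 <<< c) l

/-- From a mask of codes with digits below `3`, the mask of all codes with digits below `6` which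
agree with one of them modulo `3`. -/
def periodicMask (M : ℕ) : ℕ :=
  [0, 1, 2, 3, 4, 5].foldl (fun M i => M ||| M <<< (3 * 6 ^ i)) M

/-- Mask of all codes with digits below `3`. -/
def boxMask : ℕ :=
  bitMask ((List.range 729).map fun k => code (combDigits 1 0 k))

/-- For all vectors `x` and `y`, one of `x`, `y`, `y + x`, `y - x` is in the set with mask `M`. -/
def meetsAllLines (M : ℕ) : Bool :=
  (List.range 729).all fun k => M.testBit (code (combDigits 1 0 k)) ||
    boxMask &&& (M ||| M >>> code (combDigits 1 0 k) ||| M >>> code (combDigits 2 0 k)) == boxMask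

/-- Boolean test for a list of encoded lines to be a maximal partial line spread. -/
def isMaximalSpreadCode (L : List ℕ) : Bool :=
  freshPositions 1 (L.flatMap pointCodes) &&
    meetsAllLines (periodicMask (bitMask (0 :: L.flatMap pointCodes)))

lemma code_add (d e : ℕ → ℕ) : code (d + e) = code d + code e := by
  simp only [code, Pi.add_apply]
  ring

lemma code_injOn {d e : ℕ → ℕ} (hd : ∀ k, d k < 6) (he : ∀ k, e k < 6) (h : code d = code e) :
    ∀ k < 6, d k = e k := by
  simp only [code] at h
  have := hd 0; have := hd 1; have := hd 2; have := hd 3; have := hd 4; have := hd 5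
  have := he 0; have := he 1; have := he 2; have := he 3; have := he 4; have := he 5
  intro k hk
  interval_cases k <;> omega

lemma combDigits_lt (i j c k : ℕ) : combDigits i j c k < 3 := Nat.mod_lt _ (by norm_num)

lemma exists_combDigits_eq {d : ℕ → ℕ} (hd : ∀ k, d k < 3) :
    ∃ c < 729, ∀ k < 6, combDigits 1 0 c k = d k := by
  have := hd 0; have := hd 1; have := hd 2; have := hd 3; have := hd 4; have := hd 5
  refine ⟨d 0 + 3 * d 1 + 9 * d 2 + 27 * d 3 + 81 * d 4 + 243 * d 5, by omega, fun k hk => ?_⟩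
  simp only [combDigits, one_mul, zero_mul, add_zero]
  interval_cases k <;> norm_num <;> omega

lemma code_combDigits_mem_pointCodes {i j : ℕ} (c : ℕ) (hi : i < 3) (hj : j < 3)
    (h : ¬(i = 0 ∧ j = 0)) : code (combDigits i j c) ∈ pointCodes c := by
  refine List.mem_map.2 ⟨(i, j), ?_, rfl⟩
  interval_cases i <;> interval_cases j <;> simp_all

lemma testBit_one_shiftLeft (c k : ℕ) : (1 <<< c).testBit k = decide (c = k) := by
  rw [Nat.one_shiftLeft, Nat.testBit_two_pow]

lemma testBit_bitMask (l : List ℕ) (k : ℕ) : (bitMask l).testBit k = true ↔ k ∈ l := by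
  induction l with
  | nil => simp [bitMask]
  | cons c l ih =>
    rw [bitMask, List.foldr_cons, ← bitMask, Nat.testBit_or, testBit_one_shiftLeft,
      Bool.or_eq_true, ih, decide_eq_true_iff, List.mem_cons, eq_comm]

lemma nodup_of_freshPositions {l : List ℕ} {M : ℕ} (h : freshPositions M l = true) :
    l.Nodup ∧ ∀ c ∈ l, M.testBit c = false := by
  induction l generalizing M with
  | nil => simp
  | cons c l ih =>
    simp only [freshPositions, Bool.and_eq_true, Bool.not_eq_true'] at h
    obtain ⟨hl, hM⟩ := ih h.2
    simp only [Nat.testBit_or, testBit_one_shiftLeft, Bool.or_eq_false_iff,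
      decide_eq_false_iff_not] at hM
    refine ⟨List.nodup_cons.2 ⟨fun hc => (hM c hc).2 rfl, hl⟩, fun b hb => ?_⟩
    rcases List.mem_cons.1 hb with rfl | hb
    exacts [h.1, (hM b hb).1]

lemma testBit_of_land_eq {B M k : ℕ} (h : B &&& M = B) (hk : B.testBit k = true) :
    M.testBit k = true := by
  rw [← h, Nat.testBit_and, Bool.and_eq_true] at hk
  exact hk.2

end Codes

section Vectors

variable {F : Type*} [Field F]

/-- The vector of `F^6` with the given digits. -/
def vec (F : Type*) [Field F] (d : ℕ → ℕ) : Fin 6 → F := fun k => (d k : F)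

/-- The line encoded by `c`. -/
def line (F : Type*) [Field F] (c : ℕ) : Submodule F (Fin 6 → F) :=
  Submodule.span F {vec F (fun k => c / 3 ^ k), vec F (fun k => c / 3 ^ (k + 6))}

lemma vec_add (d e : ℕ → ℕ) : vec F (d + e) = vec F d + vec F e := by
  ext k
  simp [vec]

lemma vec_congr {d e : ℕ → ℕ} (h : ∀ k < 6, d k = e k) : vec F d = vec F e := by
  ext k
  simp [vec, h k k.2]

lemma exists_vec_eq (hF : ∀ x : F, ∃ n : ℕ, n < 3 ∧ (n : F) = x) (x : Fin 6 → F) :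
    ∃ c < 729, vec F (combDigits 1 0 c) = x := by
  choose f hf hfx using hF
  obtain ⟨c, hc, hd⟩ := exists_combDigits_eq
    (d := fun k => if h : k < 6 then f (x ⟨k, h⟩) else 0)
    (fun k => by split_ifs; exacts [hf _, by norm_num])
  refine ⟨c, hc, ?_⟩
  rw [vec_congr hd]
  ext k
  simp [vec, hfx]

variable [CharP F 3]

lemma vec_combDigits (i j c : ℕ) : vec F (combDigits i j c) =
    (i : F) • vec F (fun k => c / 3 ^ k) + (j : F) • vec F (fun k => c / 3 ^ (k + 6)) := by
  ext k
  simp only [vec, combDigits, Pi.add_apply, Pi.smul_apply, smul_eq_mul]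
  rw [← CharP.cast_eq_mod F 3]
  push_cast
  rfl

lemma vec_combDigits_two (c : ℕ) : vec F (combDigits 2 0 c) = -vec F (combDigits 1 0 c) := by
  have h3 : (3 : F) = 0 := by exact_mod_cast CharP.cast_eq_zero F 3
  have h2 : (2 : F) = -1 := by linear_combination h3
  simp [vec_combDigits, h2]

lemma code_eq_of_vec_eq {d e : ℕ → ℕ} (hd : ∀ k, d k < 3) (he : ∀ k, e k < 3)
    (h : vec F d = vec F e) : code d = code e := by
  have key (k : Fin 6) : d k = e k :=
    CharP.natCast_injOn_Iio F 3 (hd k) (he k) (congrFun h k)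
  have h0 := key 0
  have h1 := key 1
  have h2 := key 2
  have h3 := key 3
  have h4 := key 4
  have h5 := key 5
  simp only [Fin.isValue, Fin.coe_ofNat_eq_mod] at h0 h1 h2 h3 h4 h5
  norm_num at h0 h1 h2 h3 h4 h5
  simp only [code, h0, h1, h2, h3, h4, h5]

lemma vec_combDigits_ne_zero {i j c : ℕ} (h0 : 0 ∉ pointCodes c) (hi : i < 3) (hj : j < 3)
    (h : ¬(i = 0 ∧ j = 0)) : vec F (combDigits i j c) ≠ 0 := by
  intro hv
  have : code (combDigits i j c) = code 0 :=
    code_eq_of_vec_eq (F := F) (combDigits_lt i j c) (by simp) (by rw [hv]; ext; simp [vec])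
  have hmem := code_combDigits_mem_pointCodes c hi hj h
  rw [this] at hmem
  exact h0 hmem

/-- If all codes set in `M` are codes of vectors in `U`, then so are those of its periodic
extension. -/
lemma vec_mem_of_testBit_periodicMask {U : Set (Fin 6 → F)} {M : ℕ}
    (hM : ∀ c, M.testBit c = true → ∃ d : ℕ → ℕ, (∀ k, d k < 3) ∧ code d = c ∧ vec F d ∈ U)
    {e : ℕ → ℕ} (he : ∀ k, e k < 6) (h : (periodicMask M).testBit (code e) = true) :
    vec F e ∈ U := by
  let P (M i : ℕ) : Prop := ∀ c, M.testBit c = true → ∃ d : ℕ → ℕ,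
    (∀ k, d k < 6) ∧ (∀ k, i ≤ k → d k < 3) ∧ code d = c ∧ vec F d ∈ U
  have step (M i : ℕ) (hi : i < 6) (h : P M i) : P (M ||| M <<< (3 * 6 ^ i)) (i + 1) := by
    intro c hc
    rw [Nat.testBit_or, Bool.or_eq_true, Nat.testBit_shiftLeft, Bool.and_eq_true,
      decide_eq_true_iff] at hc
    rcases hc with hc | ⟨hle, hc⟩
    · obtain ⟨d, h6, h3, hd⟩ := h c hc
      exact ⟨d, h6, fun k hk => h3 k (by omega), hd⟩
    · obtain ⟨d, h6, h3, hd, hU⟩ := h _ hc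
      refine ⟨d + Pi.single i 3, fun k => ?_, fun k hk => ?_, ?_, ?_⟩
      · rcases eq_or_ne k i with rfl | hk
        · simpa using add_lt_add_left (h3 k le_rfl) 3
        · simpa [hk] using h6 k
      · have : k ≠ i := by omega
        simpa [this] using h3 k (by omega)
      · have : code (Pi.single i 3) = 3 * 6 ^ i := by
          interval_cases i <;> simp [code]
        rw [code_add, hd, this]
        omega
      · have h3 : (3 : F) = 0 := by exact_mod_cast CharP.cast_eq_zero F 3
        have : vec F (Pi.single i 3) = 0 := by
          ext k
          rcases eq_or_ne (k : ℕ) i with hk | hk <;> simp [vec, hk, h3]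
        rwa [vec_add, this, add_zero]
  have hP : P (periodicMask M) 6 := by
    simp only [periodicMask, List.foldl_cons, List.foldl_nil]
    refine step _ 5 (by norm_num) <| step _ 4 (by norm_num) <| step _ 3 (by norm_num) <|
      step _ 2 (by norm_num) <| step _ 1 (by norm_num) <| step _ 0 (by norm_num) fun c hc => ?_
    obtain ⟨d, h3, hd⟩ := hM c hc
    exact ⟨d, fun k => (h3 k).trans (by norm_num), fun k _ => h3 k, hd⟩
  obtain ⟨d, h6, -, hd, hU⟩ := hP _ h
  rwa [vec_congr (code_injOn he h6 hd.symm)]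

end Vectors

section Field

variable {F : Type*} [Field F] [CharP F 3]

lemma mem_line_iff (hF : ∀ x : F, ∃ n : ℕ, n < 3 ∧ (n : F) = x) {c : ℕ} {x : Fin 6 → F} :
    x ∈ line F c ↔ ∃ i < 3, ∃ j < 3, vec F (combDigits i j c) = x := by
  rw [line, Submodule.mem_span_pair]
  constructor
  · rintro ⟨s, t, rfl⟩
    obtain ⟨i, hi, rfl⟩ := hF s
    obtain ⟨j, hj, rfl⟩ := hF t
    exact ⟨i, hi, j, hj, vec_combDigits i j c⟩
  · rintro ⟨i, -, j, -, rfl⟩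
    exact ⟨i, j, (vec_combDigits i j c).symm⟩

lemma exists_mem_pointCodes (hF : ∀ x : F, ∃ n : ℕ, n < 3 ∧ (n : F) = x) {c : ℕ}
    {x : Fin 6 → F} (hx : x ∈ line F c) (hx0 : x ≠ 0) :
    ∃ d : ℕ → ℕ, (∀ k, d k < 3) ∧ code d ∈ pointCodes c ∧ vec F d = x := by
  obtain ⟨i, hi, j, hj, rfl⟩ := (mem_line_iff hF).1 hx
  refine ⟨_, combDigits_lt i j c, code_combDigits_mem_pointCodes c hi hj ?_, rfl⟩
  rintro ⟨rfl, rfl⟩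
  exact hx0 (by simp [vec_combDigits])

lemma exists_vec_mem_line {c p : ℕ} (hp : p ∈ pointCodes c) :
    ∃ d : ℕ → ℕ, (∀ k, d k < 3) ∧ code d = p ∧ vec F d ∈ line F c := by
  obtain ⟨⟨i, j⟩, -, rfl⟩ := List.mem_map.1 hp
  exact ⟨_, combDigits_lt i j c, rfl,
    Submodule.mem_span_pair.2 ⟨i, j, (vec_combDigits i j c).symm⟩⟩

lemma finrank_line (hF : ∀ x : F, ∃ n : ℕ, n < 3 ∧ (n : F) = x) {c : ℕ}
    (h0 : 0 ∉ pointCodes c) : Module.finrank F (line F c) = 2 := by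
  have hli : LinearIndependent F
      ![vec F (fun k => c / 3 ^ k), vec F (fun k => c / 3 ^ (k + 6))] := by
    rw [LinearIndependent.pair_iff]
    intro s t hst
    obtain ⟨i, hi, rfl⟩ := hF s
    obtain ⟨j, hj, rfl⟩ := hF t
    rw [← vec_combDigits] at hst
    by_contra h
    refine vec_combDigits_ne_zero h0 hi hj (fun hij => h ?_) hst
    simp [hij.1, hij.2]
  rw [line, ← Matrix.range_cons_cons_empty _ _ ![], finrank_span_eq_card hli, Fintype.card_fin]

lemma line_inf_line_eq_bot (hF : ∀ x : F, ∃ n : ℕ, n < 3 ∧ (n : F) = x) {b c : ℕ}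
    (h : (pointCodes b).Disjoint (pointCodes c)) : line F b ⊓ line F c = ⊥ := by
  rw [Submodule.eq_bot_iff]
  rintro x ⟨hb, hc⟩
  by_contra hx
  obtain ⟨d, hd, hdb, rfl⟩ := exists_mem_pointCodes hF hb hx
  obtain ⟨e, he, hec, hde⟩ := exists_mem_pointCodes hF hc hx
  exact h hdb (code_eq_of_vec_eq he hd hde ▸ hec)

lemma exists_mem_of_meetsAllLines (hF : ∀ x : F, ∃ n : ℕ, n < 3 ∧ (n : F) = x) {M : ℕ}
    (h : meetsAllLines (periodicMask M) = true) {U : Set (Fin 6 → F)}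
    (hM : ∀ c, M.testBit c = true → ∃ d : ℕ → ℕ, (∀ k, d k < 3) ∧ code d = c ∧ vec F d ∈ U)
    (x y : Fin 6 → F) : x ∈ U ∨ y ∈ U ∨ y + x ∈ U ∨ y - x ∈ U := by
  obtain ⟨a, ha, rfl⟩ := exists_vec_eq hF x
  obtain ⟨b, hb, rfl⟩ := exists_vec_eq hF y
  have lt_six (i j c : ℕ) (k : ℕ) : combDigits i j c k < 6 :=
    (combDigits_lt i j c k).trans (by norm_num)
  have add_lt_six (i j c i' j' c' : ℕ) (k : ℕ) :
      (combDigits i j c + combDigits i' j' c') k < 6 :=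
    add_lt_add (combDigits_lt i j c k) (combDigits_lt i' j' c' k)
  have hab := List.all_eq_true.1 h a (List.mem_range.2 ha)
  rw [Bool.or_eq_true, beq_iff_eq] at hab
  rcases hab with hab | hab
  · exact .inl (vec_mem_of_testBit_periodicMask hM (lt_six _ _ _) hab)
  · have hbox : boxMask.testBit (code (combDigits 1 0 b)) = true :=
      (testBit_bitMask _ _).2 (List.mem_map.2 ⟨b, List.mem_range.2 hb, rfl⟩)
    have := testBit_of_land_eq hab hbox
    simp only [Nat.testBit_or, Nat.testBit_shiftRight, Bool.or_eq_true, ← code_add] at this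
    rcases this with (hb | hb) | hb
    · exact .inr (.inl (vec_mem_of_testBit_periodicMask hM (lt_six _ _ _) hb))
    · have := vec_mem_of_testBit_periodicMask hM (add_lt_six _ _ _ _ _ _) hb
      rw [vec_add, add_comm] at this
      exact .inr (.inr (.inl this))
    · have := vec_mem_of_testBit_periodicMask hM (add_lt_six _ _ _ _ _ _) hb
      rw [vec_add, vec_combDigits_two, neg_add_eq_sub] at this
      exact .inr (.inr (.inr this))

theorem exists_isMaximalPartialLineSpread (hF : ∀ x : F, ∃ n : ℕ, n < 3 ∧ (n : F) = x)
    {L : List ℕ} (hL : isMaximalSpreadCode L = true) :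
    ∃ S : Set (Submodule F (Fin 6 → F)),
      IsMaximalPartialLineSpread F 6 S ∧ S.ncard = L.length := by
  rw [isMaximalSpreadCode, Bool.and_eq_true] at hL
  obtain ⟨hfresh, hmeet⟩ := hL
  obtain ⟨hnodup, hne⟩ := nodup_of_freshPositions hfresh
  have h0 (c : ℕ) (hc : c ∈ L) : 0 ∉ pointCodes c := fun h =>
    absurd (hne 0 (List.mem_flatMap.2 ⟨c, hc, h⟩)) (by simp)
  have hpair := (List.nodup_flatMap.1 hnodup).2
  have hdisj (b : ℕ) (hb : b ∈ L) (c : ℕ) (hc : c ∈ L) (hbc : b ≠ c) :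
      line F b ⊓ line F c = ⊥ := by
    have : Std.Symm (Function.onFun List.Disjoint pointCodes) := ⟨fun _ _ h => h.symm⟩
    exact line_inf_line_eq_bot hF (hpair.forall hb hc hbc)
  have hinj : Set.InjOn (line F) {c | c ∈ L} := by
    intro b hb c hc hbc
    by_contra hne
    have hbot := hdisj b hb c hc hne
    rw [← hbc, inf_idem] at hbot
    have := finrank_line hF (h0 b hb)
    rw [hbot, finrank_bot] at this
    omega
  have hLnodup : L.Nodup := by
    refine hpair.imp fun {b c} h hbc => ?_
    subst hbc
    exact h List.mem_cons_self List.mem_cons_self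
  refine ⟨line F '' {c | c ∈ L}, ⟨⟨?_, ?_⟩, ?_⟩, ?_⟩
  · rintro _ ⟨c, hc, rfl⟩
    exact finrank_line hF (h0 c hc)
  · rintro _ ⟨b, hb, rfl⟩ _ ⟨c, hc, rfl⟩ hbc
    exact hdisj b hb c hc (fun h => hbc (h ▸ rfl))
  · intro m hm
    let B := Module.finBasisOfFinrankEq F m hm
    have hli (s t : F) (h : s • B 0 + t • B 1 = 0) : s = 0 ∧ t = 0 := by
      have := Fintype.linearIndependent_iff.1 B.linearIndependent ![s, t]
        (by simpa [Fin.sum_univ_two] using h)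
      exact ⟨this 0, this 1⟩
    have key (x : m) (hx : x ≠ 0) (hU : (x : Fin 6 → F) ∈ {z | z = 0 ∨ ∃ c ∈ L, z ∈ line F c}) :
        ∃ l ∈ line F '' {c | c ∈ L}, m ⊓ l ≠ ⊥ := by
      rcases hU with hU | ⟨c, hc, hU⟩
      · exact absurd (Subtype.ext hU) hx
      · refine ⟨_, ⟨c, hc, rfl⟩, fun h => hx (Subtype.ext ?_)⟩
        exact (Submodule.eq_bot_iff _).1 h x ⟨x.2, hU⟩
    have hx : B 0 ≠ 0 := fun h => one_ne_zero (hli 1 0 (by simp [h])).1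
    have hy : B 1 ≠ 0 := fun h => one_ne_zero (hli 0 1 (by simp [h])).2
    have hadd : B 1 + B 0 ≠ 0 := fun h => one_ne_zero (hli 1 1 (by simpa [add_comm] using h)).1
    have hsub : B 1 - B 0 ≠ 0 := sub_ne_zero.2 (B.injective.ne (by decide))
    have hmask (p : ℕ) (hp : (bitMask (0 :: L.flatMap pointCodes)).testBit p = true) :
        ∃ d : ℕ → ℕ, (∀ k, d k < 3) ∧ code d = p ∧
          vec F d ∈ {z | z = 0 ∨ ∃ c ∈ L, z ∈ line F c} := by
      rcases List.mem_cons.1 ((testBit_bitMask _ _).1 hp) with rfl | hp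
      · exact ⟨0, by simp, rfl, .inl (by ext; simp [vec])⟩
      · obtain ⟨c, hc, hp⟩ := List.mem_flatMap.1 hp
        obtain ⟨d, hd, hdp, hdc⟩ := exists_vec_mem_line (F := F) hp
        exact ⟨d, hd, hdp, .inr ⟨c, hc, hdc⟩⟩
    rcases exists_mem_of_meetsAllLines hF hmeet hmask (B 0) (B 1) with h | h | h | h
    exacts [key _ hx h, key _ hy h, key _ hadd h, key _ hsub h]
  · rw [hinj.ncard_image, ← List.coe_toFinset, Set.ncard_coe_finset,
      List.toFinset_card_of_nodup hLnodup]

lemma exists_natCast_eq {F : Type*} [Field F] [Fintype F] [CharP F 3]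
    (hq : Fintype.card F = 3) (x : F) : ∃ n : ℕ, n < 3 ∧ (n : F) = x := by
  have hinj : Function.Injective fun n : Fin 3 => ((n : ℕ) : F) := fun a b h =>
    Fin.ext (CharP.natCast_injOn_Iio F 3 a.2 b.2 h)
  obtain ⟨n, hn⟩ := ((Fintype.bijective_iff_injective_and_card _).2 ⟨hinj, by simp [hq]⟩).2 x
  exact ⟨n, n.2, hn⟩

end Field

section Examples

/-- Encoded maximal partial line spreads of PG(5,3) of the sizes `37 + 3k` for `k ≤ 7`. -/
def spreadCodesUpTo58 : List (List ℕ) :=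
  [[2188, 59076, 59824, 61264, 62029, 64215, 65640, 66388, 67828, 68596, 70761, 72952, 74392,
    75154, 77340, 80962, 83911, 86095, 94849, 101371, 103573, 107953, 112324, 113781, 116677,
    123237, 129837, 136362, 182275, 243499, 258075, 261003, 276303, 300370, 309115, 323686,
    343375],
   [2188, 59076, 59824, 61264, 62029, 64215, 65640, 66388, 67828, 68596, 70761, 72952, 74392,
    75154, 77340, 80962, 83911, 86095, 94849, 101371, 103573, 107953, 112324, 116677, 123237,
    129837, 136362, 183765, 197580, 199974, 234748, 243508, 258085, 260991, 293812, 301818,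
    321505, 343372, 359568, 372675],
   [2188, 59076, 59824, 61264, 62029, 64215, 65640, 66388, 67828, 68596, 70761, 72952, 74392,
    75154, 77340, 80962, 83911, 86095, 94849, 101371, 103573, 112324, 113781, 123237, 129837,
    136362, 177172, 180072, 196996, 203428, 218937, 232573, 234898, 239122, 258816, 265372,
    295986, 300583, 304176, 321502, 326653, 337675, 348481],
   [59076, 61264, 62029, 64215, 65640, 66388, 67828, 68596, 70761, 72952, 75154, 77340, 80962,
    83911, 86095, 94849, 101371, 103573, 107953, 112324, 113781, 116677, 123237, 129837, 136362,
    179338, 180207, 191125, 199780, 201955, 215281, 219511, 224005, 225997, 250060, 258091,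
    263172, 280681, 300367, 301815, 313516, 314929, 317136, 337537, 398865, 435954],
   [2188, 59076, 59824, 62029, 64215, 65640, 66388, 67828, 68596, 70761, 72952, 74392, 75154,
    77340, 80962, 83911, 86095, 94849, 101371, 107953, 112324, 116677, 129837, 136362, 193327,
    195568, 196855, 197730, 205690, 206527, 217263, 218865, 221629, 236280, 236941, 241356,
    242913, 256630, 260991, 278497, 291841, 293797, 298173, 318013, 320236, 321525, 323704,
    333208, 361812],
   [2188, 59076, 59824, 61264, 64215, 65640, 67828, 68596, 70761, 72952, 74392, 75154, 77340,
    80962, 86095, 94849, 101371, 107953, 112324, 113781, 116677, 123237, 136362, 186042, 189034,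
    191047, 199918, 203404, 221781, 236944, 238395, 241519, 251596, 260991, 263380, 265420,
    269947, 276469, 282877, 285181, 296059, 300463, 301882, 304068, 309118, 320041, 326806,
    330982, 333208, 339735, 401079, 405525],
   [2188, 59076, 59824, 61264, 62029, 64215, 65640, 68596, 70761, 72952, 75154, 80962, 83911,
    101371, 103573, 107953, 112324, 113781, 116677, 123237, 129837, 136362, 177888, 179343,
    180199, 184471, 205627, 210883, 213069, 217258, 232576, 236320, 238474, 245050, 252442,
    258097, 262561, 265537, 267766, 271315, 282136, 282862, 297624, 300511, 302557, 304059,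
    313588, 324535, 333226, 337546, 346354, 349941, 403335, 405417, 407613],
   [2188, 59076, 59824, 61264, 65640, 66388, 68596, 70761, 74392, 75154, 77340, 80962, 83911,
    86095, 94849, 101371, 107953, 113781, 123237, 129837, 136362, 177897, 179343, 182335,
    191235, 201946, 203556, 210901, 215193, 217335, 218851, 221854, 224035, 236248, 251605,
    258199, 258955, 264715, 278497, 280873, 287263, 291622, 293929, 296140, 300364, 307063,
    311407, 313684, 314959, 317854, 326650, 335395, 339778, 346300, 374718, 381396, 388002,
    415593]]

/-- Encoded maximal partial line spreads of PG(5,3) of the sizes `60, …, 67`. -/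
def spreadCodesFrom60 : List (List ℕ) :=
  [[59076, 59824, 62029, 65640, 66388, 67828, 70761, 72952, 74392, 75154, 80962, 83911, 86095,
    94849, 103573, 107953, 112324, 113781, 116677, 123237, 177331, 180102, 182262, 185958,
    188989, 195511, 202132, 204124, 206332, 215272, 219654, 223168, 225472, 226006, 228261,
    234967, 238396, 250234, 256729, 262450, 264628, 271228, 276313, 277882, 287332, 291007,
    293977, 310575, 315664, 317914, 321492, 333181, 335452, 336807, 337723, 348481, 352924,
    357276, 383673, 414147],
   [2188, 59076, 61264, 65640, 66388, 67828, 68596, 70761, 72952, 74392, 75154, 77340, 80962,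
    83911, 86095, 94849, 112324, 113781, 123237, 136362, 177382, 178060, 182476, 186789, 188875,
    191212, 199771, 202144, 205795, 210864, 215292, 217279, 225390, 226012, 228337, 230383,
    236205, 236965, 238522, 239200, 241354, 250213, 256624, 269815, 272059, 274114, 280816,
    283072, 284458, 298339, 301881, 304039, 311416, 315678, 335422, 337588, 341185, 359409,
    372582, 381411, 390240],
   [2188, 59076, 59824, 62029, 64215, 66388, 67828, 68596, 72952, 74392, 80962, 83911, 86095,
    101371, 103573, 112324, 123237, 129837, 136362, 177250, 177898, 182298, 186654, 188959,
    193306, 195469, 199101, 199807, 212295, 217348, 221787, 223309, 228294, 230484, 231952,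
    232744, 234763, 237082, 238411, 242794, 243505, 251614, 265522, 271398, 271996, 277759,
    287407, 291796, 295987, 297660, 300357, 304014, 309208, 323692, 333313, 339850, 357447,
    368337, 398946, 411975, 416271, 418512],
   [2188, 59076, 61264, 64222, 65640, 66388, 67828, 70761, 72952, 74392, 75154, 77340, 80962,
    83911, 86095, 94849, 113781, 123237, 136362, 177298, 177922, 179500, 189043, 191172, 193249,
    196867, 197617, 199840, 202093, 203626, 206362, 210900, 213067, 218865, 221833, 226132,
    232636, 234975, 236221, 243697, 250129, 252297, 258141, 263188, 264766, 267697, 274114,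
    284458, 289639, 291616, 297472, 309118, 317136, 317977, 320044, 328840, 335352, 339892,
    350833, 357339, 392346, 396759, 435951],
   [2188, 59076, 61264, 62029, 64215, 66388, 70761, 72952, 74392, 77340, 80962, 83911, 86095,
    94849, 101371, 107953, 113781, 116677, 129837, 178096, 183738, 184504, 186744, 192675,
    193267, 199951, 203437, 204307, 206326, 208564, 213042, 215296, 223264, 224029, 228280,
    230533, 232576, 234882, 236964, 245109, 245872, 250279, 252376, 254476, 267697, 272125,
    276520, 277761, 285232, 291724, 298174, 300370, 309190, 315673, 317125, 322249, 326650,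
    337548, 355116, 374916, 379170, 381384, 396585, 488466],
   [2188, 59076, 61264, 62029, 66369, 70761, 72970, 74392, 77311, 80962, 83911, 86095, 94849,
    99163, 101371, 107953, 113781, 129837, 178099, 179422, 180268, 183747, 184504, 186832,
    191188, 192675, 195454, 197056, 199063, 208723, 213042, 219583, 221733, 223212, 231925,
    238432, 239278, 241309, 242788, 243511, 245109, 250279, 252376, 255915, 256624, 258919,
    261151, 262573, 272158, 276300, 278530, 294025, 295986, 298174, 309190, 311338, 318031,
    326650, 337548, 341262, 350671, 363864, 392403, 484119, 486309],
   [2188, 59076, 61264, 62029, 66369, 70761, 72970, 74392, 77311, 80962, 83911, 86095, 94849,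
    99163, 101371, 107953, 113781, 129837, 178099, 179422, 180268, 182266, 183747, 184504,
    186832, 191188, 192675, 195454, 197056, 204307, 208723, 213042, 219583, 221733, 223212,
    231925, 238432, 239278, 241309, 242788, 243511, 245109, 250279, 252376, 254467, 255915,
    256777, 258919, 262573, 272158, 276300, 278530, 284470, 294025, 295986, 298174, 309190,
    311338, 326650, 337548, 341262, 350671, 392403, 401043, 484119, 486309],
   [2188, 59076, 61264, 64215, 66388, 70761, 72952, 74392, 77340, 80962, 83911, 86095, 94849,
    101371, 107953, 113781, 116677, 129837, 178096, 183738, 184504, 186744, 192675, 193267,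
    199951, 203437, 204307, 206326, 208564, 213042, 215296, 218785, 223264, 224029, 228280,
    230533, 232576, 234882, 236964, 245109, 245872, 250279, 252376, 254476, 267697, 272125,
    276520, 277761, 285232, 291724, 298174, 300370, 309190, 313534, 315673, 317125, 322249,
    326650, 331180, 337548, 355152, 374916, 379170, 381384, 394482, 396585, 488466]]

/-- Encoded maximal partial line spreads of PG(5,3) of the sizes `68, …, 77`. -/
def spreadCodesFrom68 : List (List ℕ) :=
  [[2188, 59076, 64215, 66388, 70761, 72952, 74392, 77340, 80962, 83911, 86095, 94849, 101371,
    107953, 113781, 116677, 129837, 179356, 180175, 183738, 186744, 192675, 193267, 197779,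
    199102, 199951, 202077, 203437, 204307, 206326, 208564, 213042, 215296, 223264, 226074,
    228280, 230533, 232576, 234867, 241315, 245872, 250279, 251544, 252376, 254476, 258159,
    272125, 276520, 277761, 280819, 282919, 285232, 291724, 295995, 298174, 304057, 304753,
    309190, 315883, 317125, 326620, 331180, 337723, 374916, 379170, 385758, 396585, 488466],
   [2188, 61264, 62029, 64215, 66388, 70761, 72952, 74392, 80962, 83911, 86095, 94849, 101371,
    107953, 113781, 116677, 129837, 177177, 177915, 179343, 180129, 182469, 183844, 184504,
    186766, 188892, 193267, 196920, 197724, 199951, 202143, 203437, 204307, 213042, 215248,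
    219573, 225382, 230533, 236304, 241369, 243685, 245050, 250279, 255982, 256621, 258091,
    264658, 272125, 276520, 277761, 278500, 280686, 291724, 304048, 304963, 309190, 313489,
    315673, 317125, 326782, 333307, 346501, 350707, 355116, 360882, 366075, 368265, 372555,
    388017],
   [2188, 59076, 61264, 62029, 64215, 70761, 72952, 74392, 80962, 83911, 86095, 94849, 101371,
    107953, 113781, 116677, 129837, 178096, 183738, 184504, 186744, 191089, 192675, 193267,
    197769, 199218, 199951, 203437, 204307, 206326, 208564, 213042, 215296, 223264, 224029,
    226155, 228280, 230533, 231943, 232576, 234882, 236964, 245872, 250279, 251571, 252376,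
    254476, 256015, 267697, 272125, 276520, 277761, 278701, 285232, 291724, 298174, 300370,
    309190, 315673, 317125, 317950, 322249, 326650, 331015, 337548, 355116, 368262, 379170,
    396585, 488466],
   [2188, 61264, 64215, 66388, 70761, 74392, 77340, 80962, 83911, 86095, 94087, 94849, 101371,
    113781, 129837, 160392, 177157, 177892, 179553, 180085, 182394, 185989, 186744, 193267,
    197623, 199117, 202141, 203443, 205816, 206326, 210841, 213042, 215296, 218838, 219537,
    223264, 224029, 232015, 232788, 238422, 242784, 243589, 245109, 264781, 265381, 267580,
    269761, 271218, 276520, 277891, 283018, 284395, 291805, 296029, 297490, 304846, 307108,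
    311344, 328849, 331180, 337548, 341185, 344275, 348529, 359580, 372555, 381384, 390096,
    394482, 396585, 407721],
   [20422, 59830, 61291, 61972, 64171, 67854, 72927, 104977, 177208, 177919, 179383, 180244,
    182449, 184672, 186121, 186714, 191029, 192645, 193377, 195475, 196968, 197764, 199213,
    201991, 203515, 204271, 205690, 206374, 210792, 213040, 219549, 224023, 225397, 232753,
    234975, 237001, 241408, 243556, 245788, 250083, 255904, 258943, 261148, 263380, 269794,
    271345, 272104, 276475, 278611, 280903, 285199, 300580, 301852, 310591, 311317, 314937,
    323832, 324535, 326683, 337633, 339727, 341188, 344182, 359409, 366186, 390186, 395955,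
    396795, 402489, 412059, 477561, 484104],
   [8749, 20421, 61293, 74407, 80994, 87523, 94831, 129825, 177250, 178032, 179392, 180289,
    182460, 183933, 184612, 186060, 186847, 189016, 191086, 192649, 193291, 195403, 196978,
    199873, 202080, 204217, 205582, 206386, 210757, 212232, 217387, 218920, 219558, 223210,
    223921, 225469, 228394, 230464, 232642, 236236, 236941, 239178, 241528, 250186, 256792,
    258910, 262582, 264709, 267562, 271984, 274339, 276490, 277834, 280816, 283084, 289507,
    291108, 293821, 301879, 304960, 311290, 315814, 317899, 323904, 342082, 344140, 346435,
    348673, 352846, 357237, 359436, 363969, 457833],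
   [64189, 66418, 85309, 87526, 90415, 92653, 134175, 138522, 177265, 177903, 179343, 182344,
    184494, 186822, 189046, 195448, 196914, 199759, 204217, 205716, 206397, 210898, 212350,
    212929, 215280, 218812, 219463, 221698, 225433, 230449, 231922, 232695, 234846, 236200,
    238458, 242821, 243538, 245902, 247885, 250150, 251715, 256068, 256681, 265519, 269962,
    271348, 274258, 276532, 280708, 282859, 291781, 293956, 295996, 297453, 298276, 306972,
    309099, 315832, 324547, 326593, 328828, 330277, 337714, 344239, 348592, 359553, 379263,
    381378, 390117, 398844, 407604, 414120, 422886, 488460],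
   [59119, 64191, 72936, 80920, 87528, 88231, 94786, 177346, 177960, 179353, 180291, 182260,
    186096, 186715, 191101, 192589, 195406, 196959, 197767, 199048, 199854, 202018, 203569,
    204325, 205635, 206494, 208630, 210823, 213031, 217432, 218854, 219577, 223843, 226173,
    228294, 230599, 232015, 234898, 241510, 245911, 247924, 250114, 251629, 252406, 256747,
    258276, 258910, 260991, 262534, 264792, 276298, 280894, 282321, 283066, 284392, 285100,
    287299, 291769, 296049, 302578, 304963, 309123, 311346, 317920, 323742, 361677, 368319,
    379299, 387975, 389376, 400410, 409836, 427224, 457824, 505929],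
   [24787, 59065, 59782, 61288, 77350, 87523, 94801, 101410, 110098, 159660, 177177, 179419,
    180178, 182344, 183775, 186100, 186849, 189021, 191062, 192549, 193224, 195489, 196954,
    197731, 204123, 210742, 212239, 213066, 215176, 217345, 218932, 219585, 221815, 225490,
    228306, 230584, 234895, 239161, 242902, 243667, 244999, 248083, 250087, 252262, 254469,
    258202, 262600, 267613, 269914, 271326, 272155, 277882, 280687, 282943, 289603, 296149,
    304729, 307150, 311329, 324478, 326809, 330429, 335353, 339739, 342013, 343425, 344230,
    356517, 357273, 366048, 377082, 383556, 395955, 398937, 405471, 422847],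
   [20437, 24787, 62014, 66391, 70744, 83899, 85309, 105724, 114475, 145074, 177160, 178108,
    179338, 180075, 186043, 192496, 193231, 195510, 196911, 197751, 199834, 203533, 205729,
    206391, 208630, 210898, 212257, 212929, 215283, 217480, 219508, 221809, 223239, 225415,
    228352, 230446, 231949, 232711, 234846, 238458, 239308, 245181, 256720, 261037, 263356,
    264637, 265582, 269896, 274282, 276532, 280708, 282217, 282859, 290992, 297453, 302571,
    304752, 306972, 309235, 310602, 311389, 313684, 315694, 317235, 317914, 324478, 339922,
    346384, 348592, 360882, 374931, 379263, 381378, 390117, 392412, 422886, 514683]]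

/-- Encoded maximal partial line spreads of PG(5,3) of the sizes `78, …, 88` and `91`. -/
def spreadCodesFrom78 : List (List ℕ) :=
  [[19692, 21880, 33547, 37927, 74406, 92650, 99160, 116674, 178041, 179416, 180217, 182416,
    184629, 186766, 188932, 191217, 192499, 193399, 195592, 196920, 199108, 199834, 202117,
    203535, 204199, 205723, 206458, 210790, 212257, 212992, 215293, 217416, 218797, 219604,
    221716, 223075, 225342, 226123, 228379, 230592, 234967, 236304, 237130, 242928, 243718,
    250240, 251578, 256629, 263356, 276532, 289585, 290982, 291706, 296059, 297487, 300511,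
    307144, 309235, 310582, 313669, 315814, 320257, 322330, 326782, 328873, 333334, 335488,
    339922, 342004, 348592, 353053, 355107, 368283, 381396, 394482, 401070, 407658, 422886],
   [2188, 24808, 26998, 33547, 37927, 67807, 79510, 88279, 99211, 177264, 178041, 179416,
    180241, 182416, 183897, 185926, 186703, 188971, 191208, 192499, 193399, 195592, 199108,
    199834, 202117, 203535, 205723, 213103, 215175, 217336, 218797, 219604, 221716, 223272,
    224004, 225415, 226141, 228379, 230592, 232689, 236304, 237163, 242928, 243718, 245068,
    250258, 251578, 256629, 263356, 269953, 284425, 289642, 290982, 291706, 297487, 300511,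
    304020, 310582, 313669, 315814, 320257, 322330, 326782, 333334, 335458, 339922, 341262,
    346402, 348592, 353053, 355107, 359622, 381396, 405561, 407658, 422886, 473130, 474615,
    495003],
   [2188, 19692, 24808, 26998, 33547, 37927, 92650, 99160, 177264, 178041, 179416, 180241,
    182416, 183897, 185926, 186766, 188932, 191217, 192499, 195592, 199108, 199834, 202117,
    203535, 204199, 205723, 206458, 210918, 212257, 212992, 217416, 218797, 219604, 223272,
    224004, 225415, 226123, 228379, 230592, 232711, 234967, 236304, 236937, 243718, 250240,
    251578, 256629, 263356, 269953, 276532, 284425, 287236, 289585, 290982, 291706, 296059,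
    297487, 300511, 301836, 307144, 309235, 310582, 313669, 315814, 320236, 322330, 326782,
    328873, 333334, 339922, 342004, 348592, 353053, 355107, 376995, 381396, 394482, 401070,
    407658, 422886],
   [2188, 21880, 24808, 26998, 37927, 44490, 99160, 177372, 178041, 179416, 180217, 182416,
    183897, 184629, 185926, 186766, 188932, 191217, 192565, 193399, 195592, 196920, 197742,
    199108, 199834, 202117, 203535, 205723, 206458, 210918, 212257, 212992, 215293, 217416,
    218709, 219604, 221716, 223272, 224004, 226123, 228379, 230592, 232711, 234967, 236304,
    236937, 242928, 250240, 256813, 263356, 269953, 276532, 289591, 291706, 296059, 297487,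
    300511, 301923, 307144, 309253, 313669, 315787, 320257, 322357, 326782, 328873, 333334,
    335488, 339922, 342004, 348574, 353053, 355107, 357246, 361695, 368283, 381396, 394482,
    401070, 407658, 422886],
   [2188, 21880, 24808, 26998, 33547, 37927, 79510, 92650, 99160, 177264, 178041, 179416,
    180241, 182416, 183897, 185926, 188932, 191217, 192499, 193399, 195592, 196981, 199108,
    199834, 202117, 203535, 204199, 205723, 210918, 212257, 212992, 218797, 219604, 221716,
    223272, 224004, 225415, 226123, 228379, 230538, 232711, 234967, 236304, 236937, 242928,
    243718, 250240, 251578, 256629, 263356, 269953, 276532, 284425, 289585, 291706, 296059,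
    300511, 307144, 310746, 313669, 315814, 317853, 320257, 322330, 326782, 328873, 333334,
    339922, 342004, 348592, 353053, 355107, 368283, 376995, 381396, 394482, 400302, 401070,
    407658, 411975, 422154, 422886],
   [2188, 19692, 21880, 26998, 33547, 37927, 79510, 92650, 99160, 116674, 178041, 179416,
    180217, 182416, 183897, 184629, 185926, 186766, 188932, 191217, 192499, 193399, 195592,
    196920, 199108, 199834, 202117, 203535, 204244, 205723, 206458, 210918, 212257, 215293,
    217416, 219604, 223272, 224004, 226123, 228379, 230592, 232648, 234967, 236304, 236937,
    242928, 243718, 250240, 251578, 256629, 263356, 269953, 276532, 284425, 289585, 291706,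
    296059, 300511, 301923, 307144, 309235, 310582, 313669, 315814, 320257, 322330, 326782,
    328873, 333334, 335488, 339922, 342004, 348592, 353053, 355107, 361695, 368283, 376995,
    381396, 394482, 401070, 407658, 422886],
   [2188, 19692, 20433, 21880, 24808, 26998, 33547, 37927, 92650, 99160, 177372, 178041, 179416,
    180217, 182416, 183897, 184629, 185926, 186766, 188932, 191217, 192565, 193399, 195592,
    196942, 197742, 199108, 199893, 202117, 203535, 204199, 205723, 206458, 210918, 212992,
    215293, 217416, 219604, 221716, 223272, 224004, 226123, 228373, 232711, 234967, 236304,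
    236937, 242928, 243718, 250240, 251578, 256813, 263356, 269953, 276532, 283054, 284425,
    289591, 291706, 296059, 297487, 300511, 301923, 307144, 309253, 313669, 315787, 317941,
    320257, 322357, 326782, 328873, 333334, 335488, 339922, 342004, 353053, 355113, 361695,
    368283, 381396, 394482, 401070, 422886],
   [2188, 19692, 21880, 26998, 33547, 37927, 79510, 92650, 99160, 116674, 178041, 179416,
    180217, 182416, 183897, 184629, 185926, 186766, 188932, 191217, 192499, 193399, 195592,
    196920, 199108, 199834, 202117, 203535, 204199, 205723, 206458, 210918, 212257, 212992,
    215293, 217416, 219604, 221716, 223272, 224004, 226123, 228379, 230592, 234967, 236304,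
    236937, 242928, 243718, 250240, 251578, 256629, 263356, 269953, 276532, 284425, 289585,
    291706, 296059, 297487, 300511, 301923, 307144, 309235, 310582, 313669, 315814, 320257,
    322330, 326782, 328873, 333334, 335488, 339922, 342004, 348592, 353053, 355107, 361695,
    368283, 376995, 381396, 394482, 401070, 407658, 422886],
   [2188, 19692, 20433, 21880, 24808, 26998, 33547, 37927, 92650, 99160, 177372, 178041, 179416,
    180217, 182416, 183897, 184629, 185926, 186766, 188932, 191217, 192565, 193399, 195592,
    196920, 197742, 199108, 199834, 202117, 203535, 204199, 205723, 206458, 210918, 212257,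
    212992, 215293, 217416, 219604, 221716, 223272, 224004, 226123, 228379, 230592, 232711,
    234967, 236304, 236937, 242928, 243718, 250240, 251578, 256813, 263356, 269953, 276532,
    284425, 289591, 291706, 296059, 297487, 300511, 301923, 307144, 309253, 313669, 315787,
    320257, 322357, 326782, 328873, 333334, 335488, 339922, 342004, 348574, 353053, 355107,
    361695, 368283, 381396, 394482, 401070, 407658, 422886],
   [2188, 19692, 21880, 26998, 33547, 37927, 79510, 92650, 99160, 116674, 178041, 179416,
    180160, 182416, 183897, 184629, 185926, 186778, 188932, 191217, 192499, 193399, 195592,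
    196920, 199108, 199834, 202117, 203535, 204199, 205723, 206458, 210918, 212257, 212992,
    215293, 217416, 219604, 221716, 223272, 224004, 225403, 226123, 228379, 230592, 234967,
    236304, 236937, 242928, 243718, 250240, 251578, 256629, 258982, 269953, 276532, 283048,
    284425, 289585, 291706, 296059, 297487, 300511, 301923, 307144, 309235, 310582, 313669,
    315814, 320257, 322330, 326782, 328873, 333334, 335488, 339922, 342004, 348592, 353053,
    355107, 361695, 368283, 376995, 381396, 394482, 396696, 407658, 422886],
   [2188, 19692, 20433, 21880, 22615, 24808, 26998, 33547, 37927, 40107, 178041, 179416, 180151,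
    182416, 183897, 184629, 186031, 186766, 189004, 191217, 192565, 193300, 195592, 196920,
    197742, 199108, 199843, 203535, 204330, 205723, 206458, 208675, 210918, 212268, 212992,
    215293, 217416, 218800, 219535, 221791, 223272, 224004, 225415, 226150, 228379, 230592,
    231949, 232684, 234967, 237094, 242982, 243718, 250261, 251617, 256813, 263356, 264766,
    269953, 276532, 283048, 289591, 296059, 300511, 301923, 302656, 309253, 313669, 315787,
    320257, 322402, 326782, 328873, 335488, 339922, 341343, 342004, 346447, 348673, 353053,
    355107, 360963, 361695, 368283, 372675, 374808, 394482, 401070, 407658],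
   [2188, 19692, 20433, 21880, 22615, 24808, 26998, 33547, 37927, 40107, 177228, 178041, 179416,
    180151, 182416, 183897, 184629, 186031, 186766, 189004, 191217, 192565, 193300, 195592,
    196920, 197742, 199108, 199843, 202117, 203535, 204330, 205723, 206458, 208705, 210918,
    212257, 212992, 215293, 217416, 218800, 219535, 221791, 223272, 224004, 225415, 226150,
    228379, 230592, 231949, 232684, 234967, 237094, 242982, 243718, 250261, 256813, 263356,
    269953, 276532, 283048, 289591, 296059, 300511, 301923, 302656, 307144, 309253, 313669,
    315787, 320257, 322357, 326782, 328873, 333334, 335488, 339922, 341343, 342004, 346447,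
    348574, 353053, 355107, 360963, 361695, 368283, 374808, 381396, 387984, 394482, 401070,
    407658]]

lemma isMaximalSpreadCode_of_mem_spreadCodesUpTo58 :
    ∀ L ∈ spreadCodesUpTo58, isMaximalSpreadCode L = true := by
  decide +kernel

lemma isMaximalSpreadCode_of_mem_spreadCodesFrom60 :
    ∀ L ∈ spreadCodesFrom60, isMaximalSpreadCode L = true := by
  decide +kernel

lemma isMaximalSpreadCode_of_mem_spreadCodesFrom68 :
    ∀ L ∈ spreadCodesFrom68, isMaximalSpreadCode L = true := by
  decide +kernel

lemma isMaximalSpreadCode_of_mem_spreadCodesFrom78 :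
    ∀ L ∈ spreadCodesFrom78, isMaximalSpreadCode L = true := by
  decide +kernel

/-- Encoded maximal partial line spreads of PG(5,3) of all the sizes above. -/
def spreadCodes : List (List ℕ) :=
  spreadCodesUpTo58 ++ spreadCodesFrom60 ++ spreadCodesFrom68 ++ spreadCodesFrom78

lemma isMaximalSpreadCode_of_mem {L : List ℕ} (hL : L ∈ spreadCodes) :
    isMaximalSpreadCode L = true := by
  simp only [spreadCodes, List.mem_append] at hL
  rcases hL with ((hL | hL) | hL) | hL
  exacts [isMaximalSpreadCode_of_mem_spreadCodesUpTo58 L hL,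
    isMaximalSpreadCode_of_mem_spreadCodesFrom60 L hL,
    isMaximalSpreadCode_of_mem_spreadCodesFrom68 L hL,
    isMaximalSpreadCode_of_mem_spreadCodesFrom78 L hL]

lemma map_length_spreadCodes : spreadCodes.map List.length =
    [37, 40, 43, 46, 49, 52, 55, 58] ++ List.range' 60 29 ++ [91] := by
  decide +kernel

end Examples

end LineSpread

/-- In PG(5,3), there exist maximal partial line spreads of size 37 + 3*k for
every integer k with 0 ≤ k ≤ 7, of every size n with 60 ≤ n ≤ 88, and of
size 91 (a spread). -/
theorem stmt11 (F : Type*) [Field F] [Fintype F] (hq : Fintype.card F = 3) :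
    (∀ k : ℕ, k ≤ 7 → ∃ S : Set (Submodule F (Fin 6 → F)),
      IsMaximalPartialLineSpread F 6 S ∧ S.ncard = 37 + 3 * k) ∧
    (∀ n : ℕ, 60 ≤ n → n ≤ 88 → ∃ S : Set (Submodule F (Fin 6 → F)),
      IsMaximalPartialLineSpread F 6 S ∧ S.ncard = n) ∧
    (∃ S : Set (Submodule F (Fin 6 → F)),
      IsMaximalPartialLineSpread F 6 S ∧ S.ncard = 91) := by
  have : Fact (Nat.Prime 3) := ⟨Nat.prime_three⟩
  have : CharP F 3 := charP_of_card_eq_prime hq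
  have key (n : ℕ) (hn : n ∈ LineSpread.spreadCodes.map List.length) :
      ∃ S : Set (Submodule F (Fin 6 → F)), IsMaximalPartialLineSpread F 6 S ∧ S.ncard = n := by
    obtain ⟨L, hL, rfl⟩ := List.mem_map.1 hn
    exact LineSpread.exists_isMaximalPartialLineSpread (LineSpread.exists_natCast_eq hq)
      (LineSpread.isMaximalSpreadCode_of_mem hL)
  simp only [LineSpread.map_length_spreadCodes, List.mem_append, List.mem_range'_1] at key
  refine ⟨fun k hk => key _ (.inl (.inl ?_)), fun n h60 h88 => key n (.inl (.inr ?_)),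
    key 91 (.inr (by simp))⟩
  · interval_cases k <;> simp
  · omega
end

section
/- In PG(5,4), there exist maximal partial line spreads of size 81 + 4k for every integer k with 0 ≤ k ≤ 19, of every size n with 159 ≤ n ≤ 270, and of size 273 (a spread). -/
/-! ### Coordinates

A vector of `F ^ 6` is encoded by a natural number below `4096`: bits `2 i` and `2 i + 1` are the
coordinates of its `i`-th entry in the `𝔽₂`-basis `1, ω` of `F`. -/

section Coordinates

variable {F : Type*} [Field F]

/-- The vector of `F ^ 6` with code `n`. -/
def decodeVec (ω : F) (n : ℕ) : Fin 6 → F := fun i =>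
  (if n.testBit (2 * i) then 1 else 0) + (if n.testBit (2 * i + 1) then ω else 0)

/-- The code of `ω • v`, from the code of `v`. -/
def mulOmega (n : ℕ) : ℕ :=
  Nat.xor (Nat.xor (Nat.land (Nat.shiftRight n 1) 1365) (Nat.shiftLeft (Nat.land n 1365) 1))
    (Nat.land n 2730)

lemma exists_omega [Fintype F] (hq : Fintype.card F = 4) :
    (2 : F) = 0 ∧ ∃ ω : F, ω * ω = ω + 1 := by
  have h2 : (2 : F) = 0 := by
    have h : ((Fintype.card F : ℕ) : F) = 0 := FiniteField.cast_card_eq_zero F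
    rw [hq] at h
    have h' : (2 : F) * 2 = 0 := by push_cast at h; linear_combination h
    simpa using h'
  refine ⟨h2, ?_⟩
  classical
  obtain ⟨ω, hω⟩ : ∃ ω : F, ω ∉ ({0, 1} : Finset F) := by
    by_contra! h
    have := Finset.card_le_card (fun x _ => h x : (Finset.univ : Finset F) ⊆ {0, 1})
    rw [Finset.card_univ, hq] at this
    exact absurd (this.trans Finset.card_le_two) (by norm_num)
  simp only [Finset.mem_insert, Finset.mem_singleton, not_or] at hω
  have h3 := FiniteField.pow_card_sub_one_eq_one ω hω.1
  rw [hq] at h3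
  have : (ω - 1) * (ω * ω + ω + 1) = 0 := by norm_num at h3; linear_combination h3
  refine ⟨ω, ?_⟩
  rcases mul_eq_zero.1 this with h | h
  · exact absurd (sub_eq_zero.1 h) hω.2
  · linear_combination h - (ω + 1) * h2

variable {ω : F}

lemma eq_of_card_eq_four (h2 : (2 : F) = 0) (hω : ω * ω = ω + 1)
    [Fintype F] (hq : Fintype.card F = 4) (c : F) :
    c = 0 ∨ c = 1 ∨ c = ω ∨ c = ω + 1 := by
  have hc := FiniteField.pow_card c
  rw [hq] at hc
  have : c * ((c - 1) * ((c - ω) * (c - (ω + 1)))) = 0 := by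
    linear_combination hc + (c ^ 2 - c) * hω - (c ^ 3 - c ^ 2) * (1 + ω) * h2 +
      ((c ^ 2 - c) * (1 + ω) + c - c ^ 2) * h2
  rcases mul_eq_zero.1 this with h | h
  · exact Or.inl h
  rcases mul_eq_zero.1 h with h | h
  · exact Or.inr (Or.inl (sub_eq_zero.1 h))
  rcases mul_eq_zero.1 h with h | h
  · exact Or.inr (Or.inr (Or.inl (sub_eq_zero.1 h)))
  · exact Or.inr (Or.inr (Or.inr (sub_eq_zero.1 h)))

lemma decodeVec_xor (h2 : (2 : F) = 0) (m n : ℕ) :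
    decodeVec ω (m ^^^ n) = decodeVec ω m + decodeVec ω n := by
  funext i
  simp only [decodeVec, Nat.testBit_xor, Pi.add_apply]
  cases m.testBit (2 * i) <;> cases m.testBit (2 * i + 1) <;> cases n.testBit (2 * i) <;>
    cases n.testBit (2 * i + 1) <;> simp <;> grind

lemma testBit_mulOmega (n : ℕ) (i : Fin 6) :
    (mulOmega n).testBit (2 * i) = n.testBit (2 * i + 1) ∧
    (mulOmega n).testBit (2 * i + 1) = (n.testBit (2 * i) ^^ n.testBit (2 * i + 1)) := by
  have hn : mulOmega n = ((n >>> 1) &&& 1365) ^^^ ((n &&& 1365) <<< 1) ^^^ (n &&& 2730) := rfl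
  simp only [hn, Nat.testBit_xor, Nat.testBit_and, Nat.testBit_shiftLeft,
    Nat.testBit_shiftRight]
  have h : ∀ i : Fin 6, Nat.testBit 1365 (2 * i) = true ∧ Nat.testBit 1365 (2 * i + 1) = false ∧
      Nat.testBit 2730 (2 * i) = false ∧ Nat.testBit 2730 (2 * i + 1) = true := by decide
  obtain ⟨h₁, h₂, h₃, h₄⟩ := h i
  have h₅ : (decide (2 * (i : ℕ) ≥ 1) && (n.testBit (2 * i - 1) && Nat.testBit 1365 (2 * i - 1)))
      = false := by
    fin_cases i <;> simp [Nat.testBit, Nat.shiftRight_eq_div_pow]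
  rw [h₅]
  simp [h₁, h₂, h₃, h₄, Nat.add_comm 1]

lemma decodeVec_mulOmega (h2 : (2 : F) = 0) (hω : ω * ω = ω + 1)
    (n : ℕ) : decodeVec ω (mulOmega n) = ω • decodeVec ω n := by
  funext i
  simp only [decodeVec, (testBit_mulOmega n i).1, (testBit_mulOmega n i).2, Pi.smul_apply]
  cases n.testBit (2 * i) <;> cases n.testBit (2 * i + 1) <;> simp <;> grind

lemma decodeVec_apply_eq_zero (hω : ω * ω = ω + 1) {n : ℕ} {i : Fin 6} (h : decodeVec ω n i = 0) :
    n.testBit (2 * i) = false ∧ n.testBit (2 * i + 1) = false := by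
  have h0 : ω ≠ 0 := by rintro rfl; simp at hω
  have h1 : ω + 1 ≠ 0 := by rw [← hω]; exact mul_ne_zero h0 h0
  revert h
  simp only [decodeVec]
  cases n.testBit (2 * i) <;> cases n.testBit (2 * i + 1) <;> simp [h0, add_comm 1 ω, h1]

lemma lt_two_pow_of_decodeVec (hω : ω * ω = ω + 1) {n : ℕ} (k : ℕ) (hn : n < 4096)
    (h : ∀ i : Fin 6, k ≤ i → decodeVec ω n i = 0) : n < 2 ^ (2 * k) := by
  refine Nat.lt_pow_two_of_testBit _ fun j hj => ?_
  by_cases hj' : j < 12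
  · have := decodeVec_apply_eq_zero hω (h ⟨j / 2, by omega⟩ (by simp; omega))
    rcases Nat.mod_two_eq_zero_or_one j with hm | hm
    · convert this.1 using 2; simp; omega
    · convert this.2 using 2; simp; omega
  · exact Nat.testBit_lt_two_pow (hn.trans_le (by
      calc 4096 = 2 ^ 12 := by norm_num
        _ ≤ 2 ^ j := Nat.pow_le_pow_right (by norm_num) (by omega)))

lemma decodeVec_injOn (h2 : (2 : F) = 0) (hω : ω * ω = ω + 1)
    {m n : ℕ} (hm : m < 4096) (hn : n < 4096)
    (h : decodeVec ω m = decodeVec ω n) : m = n := by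
  have h0 : decodeVec ω (m ^^^ n) = 0 := by
    rw [decodeVec_xor h2, h, ← two_smul F, h2, zero_smul]
  have := lt_two_pow_of_decodeVec hω 0 (Nat.xor_lt_two_pow (n := 12) hm hn)
    fun i _ => congrFun h0 i
  exact Nat.xor_eq_zero_iff.1 (by omega)

lemma exists_decodeVec_eq (h2 : (2 : F) = 0) (hω : ω * ω = ω + 1)
    [Fintype F] (hq : Fintype.card F = 4) (v : Fin 6 → F) :
    ∃ n < 4096, decodeVec ω n = v := by
  classical
  have hinj : Function.Injective fun n : Fin 4096 => decodeVec ω n :=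
    fun m n h => Fin.ext (decodeVec_injOn h2 hω m.2 n.2 h)
  have hbij := (Fintype.bijective_iff_injective_and_card _).2 ⟨hinj, by simp [hq]⟩
  obtain ⟨n, hn⟩ := hbij.2 v
  exact ⟨n, n.2, hn⟩

end Coordinates

/-! ### Lines -/

section Lines

/-- The codes of the nonzero vectors of the line spanned by the vectors with codes `l.1`, `l.2`. -/
def lineCodes (l : ℕ × ℕ) : List ℕ :=
  let u := l.1
  let v := l.2
  let u₁ := mulOmega u
  let v₁ := mulOmega v
  let u₂ := u ^^^ u₁
  let v₂ := v ^^^ v₁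
  [u, u₁, u₂, v, v₁, v₂, u ^^^ v, u ^^^ v₁, u ^^^ v₂, u₁ ^^^ v, u₁ ^^^ v₁, u₁ ^^^ v₂,
    u₂ ^^^ v, u₂ ^^^ v₁, u₂ ^^^ v₂]

variable {F : Type*} [Field F] {ω : F}

/-- The line spanned by the vectors with codes `l.1`, `l.2`. -/
def lineSpan (ω : F) (l : ℕ × ℕ) : Submodule F (Fin 6 → F) :=
  Submodule.span F {decodeVec ω l.1, decodeVec ω l.2}

lemma exists_mem_lineCodes (h2 : (2 : F) = 0) (hω : ω * ω = ω + 1)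
    [Fintype F] (hq : Fintype.card F = 4) (l : ℕ × ℕ) (c d : F)
    (hcd : ¬(c = 0 ∧ d = 0)) :
    ∃ n ∈ lineCodes l, decodeVec ω n = c • decodeVec ω l.1 + d • decodeVec ω l.2 := by
  rcases eq_of_card_eq_four h2 hω hq c with rfl | rfl | rfl | rfl <;>
  rcases eq_of_card_eq_four h2 hω hq d with rfl | rfl | rfl | rfl <;>
  first
    | exact absurd ⟨rfl, rfl⟩ hcd
    | simp [lineCodes, decodeVec_xor h2, decodeVec_mulOmega h2 hω, add_smul, add_comm,
        add_left_comm]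

lemma decodeVec_mem_lineSpan (h2 : (2 : F) = 0) (hω : ω * ω = ω + 1)
    {l : ℕ × ℕ} {n : ℕ} (hn : n ∈ lineCodes l) :
    decodeVec ω n ∈ lineSpan ω l := by
  have hu : decodeVec ω l.1 ∈ lineSpan ω l := Submodule.subset_span (by simp)
  have hv : decodeVec ω l.2 ∈ lineSpan ω l := Submodule.subset_span (by simp)
  have hx : ∀ {a b : ℕ}, decodeVec ω a ∈ lineSpan ω l → decodeVec ω b ∈ lineSpan ω l →
      decodeVec ω (a ^^^ b) ∈ lineSpan ω l := fun ha hb => by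
    rw [decodeVec_xor h2]; exact add_mem ha hb
  have hm : ∀ {a : ℕ}, decodeVec ω a ∈ lineSpan ω l → decodeVec ω (mulOmega a) ∈ lineSpan ω l :=
    fun ha => by rw [decodeVec_mulOmega h2 hω]; exact Submodule.smul_mem _ _ ha
  have hu₁ := hm hu
  have hv₁ := hm hv
  have hu₂ := hx hu hu₁
  have hv₂ := hx hv hv₁
  simp only [lineCodes, List.mem_cons, List.not_mem_nil, or_false] at hn
  rcases hn with h | h | h | h | h | h | h | h | h | h | h | h | h | h | h <;> subst h <;>
    first | assumption | exact hx ‹_› ‹_›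

lemma finrank_lineSpan (h2 : (2 : F) = 0) (hω : ω * ω = ω + 1)
    [Fintype F] (hq : Fintype.card F = 4) {l : ℕ × ℕ}
    (hl : ∀ n ∈ lineCodes l, n ≠ 0 ∧ n < 4096) : Module.finrank F (lineSpan ω l) = 2 := by
  have hli : LinearIndependent F ![decodeVec ω l.1, decodeVec ω l.2] := by
    refine LinearIndependent.pair_iff.2 fun c d h => ?_
    by_contra hcd
    obtain ⟨n, hn, hn'⟩ := exists_mem_lineCodes h2 hω hq l c d hcd
    have h0 : decodeVec ω 0 = 0 := by funext i; simp [decodeVec]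
    exact (hl n hn).1 (decodeVec_injOn h2 hω (hl n hn).2 (by norm_num) (by rw [hn', h, h0]))
  have := finrank_span_eq_card hli
  rwa [Matrix.range_cons_cons_empty, Fintype.card_fin] at this

lemma lineSpan_inf_eq_bot (h2 : (2 : F) = 0) (hω : ω * ω = ω + 1)
    [Fintype F] (hq : Fintype.card F = 4) {l l' : ℕ × ℕ}
    (hl : ∀ n ∈ lineCodes l, n < 4096) (hl' : ∀ n ∈ lineCodes l', n < 4096)
    (h : ∀ n ∈ lineCodes l, n ∉ lineCodes l') : lineSpan ω l ⊓ lineSpan ω l' = ⊥ := by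
  refine (Submodule.eq_bot_iff _).2 fun x ⟨hx, hx'⟩ => ?_
  obtain ⟨a, b, rfl⟩ := Submodule.mem_span_pair.1 hx
  obtain ⟨c, d, hcd⟩ := Submodule.mem_span_pair.1 hx'
  by_cases h0 : a = 0 ∧ b = 0
  · simp [h0]
  by_cases h0' : c = 0 ∧ d = 0
  · rw [← hcd]; simp [h0']
  obtain ⟨n, hn, hn'⟩ := exists_mem_lineCodes h2 hω hq l a b h0
  obtain ⟨m, hm, hm'⟩ := exists_mem_lineCodes h2 hω hq l' c d h0'
  have : n = m := decodeVec_injOn h2 hω (hl n hn) (hl' m hm) (by rw [hn', hm', hcd])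
  exact absurd (this ▸ hm) (h n hn)

end Lines

/-! ### Sets of codes as bit masks -/

section Masks

/-- The set of the codes in a list, as a bit mask. -/
def listMask (ns : List ℕ) : ℕ := ns.foldr (fun n m => Nat.lor (Nat.shiftLeft 1 n) m) 0

lemma testBit_listMask (ns : List ℕ) (n : ℕ) : (listMask ns).testBit n = true ↔ n ∈ ns := by
  induction ns with
  | nil => simp [listMask]
  | cons a ns ih =>
    rw [show listMask (a :: ns) = 1 <<< a ||| listMask ns from rfl, Nat.testBit_or,
      Bool.or_eq_true, List.mem_cons, ih, Nat.one_shiftLeft, Nat.testBit_two_pow]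
    simp [eq_comm]

/-- The mask of the codes below `4096` whose bit `b` is `0`. -/
def zeroBitMask (b : ℕ) : ℕ := (2 ^ 4096 - 1) / (2 ^ 2 ^ b + 1)

/-- The image of a mask under `n ↦ n ^^^ 2 ^ b`. -/
def flipBit (b m : ℕ) : ℕ :=
  ((m &&& zeroBitMask b) <<< 2 ^ b) ||| ((m >>> 2 ^ b) &&& zeroBitMask b)

/-- The image of a mask under `n ↦ n ^^^ p % 2 ^ k`. -/
def xorTranslate (m p : ℕ) : ℕ → ℕ
  | 0 => m
  | k + 1 => bif p.testBit k then flipBit k (xorTranslate m p k) else xorTranslate m p k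

/-- Checks `zeroBitMask b` and the effect of flipping bit `b` at the code `n`. -/
def checkBit (b n : ℕ) : Bool :=
  bif n.testBit b then
    Nat.ble (2 ^ b) n && Nat.beq (n - 2 ^ b) (n ^^^ 2 ^ b) &&
      (zeroBitMask b).testBit (n - 2 ^ b) && !(zeroBitMask b).testBit n
  else
    Nat.beq (2 ^ b + n) (n ^^^ 2 ^ b) && (zeroBitMask b).testBit n &&
      (!Nat.ble (2 ^ b) n || !(zeroBitMask b).testBit (n - 2 ^ b))

lemma checkBit_eq_true {b n : ℕ} (hb : b < 6) (hn : n < 4096) : checkBit b n = true := by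
  have h : ((List.range 6).all fun b => (List.range 64).all fun a =>
      (List.range' (64 * a) 64).all (checkBit b)) = true := by decide +kernel
  simp only [List.all_eq_true, List.mem_range, List.mem_range'_1] at h
  exact h b hb (n / 64) (by omega) n (by omega)

lemma testBit_flipBit {b n : ℕ} (m : ℕ) (hb : b < 6) (hn : n < 4096) :
    (flipBit b m).testBit n = m.testBit (n ^^^ 2 ^ b) := by
  simp only [flipBit, Nat.testBit_or, Nat.testBit_shiftLeft, Nat.testBit_and,
    Nat.testBit_shiftRight]
  have hcheck := checkBit_eq_true hb hn
  rw [checkBit] at hcheck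
  cases hbit : n.testBit b <;>
    simp only [hbit, cond_true, cond_false, Bool.and_eq_true, Bool.or_eq_true,
      Bool.not_eq_eq_eq_not, Bool.not_true, Nat.beq_eq, Nat.ble_eq] at hcheck
  · obtain ⟨⟨hx, h⟩, h'⟩ := hcheck
    by_cases hle : 2 ^ b ≤ n
    · have h'' := h'.resolve_left (by simp [Nat.ble_eq_true_of_le hle])
      simp [h, h'', hx]
    · simp [h, hle, hx]
  · obtain ⟨⟨⟨hle, hx⟩, h⟩, h'⟩ := hcheck
    rw [hx] at h
    simp [h, h', hle, hx]

lemma xor_mod_two_pow_succ : ∀ p < 64, ∀ k < 6,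
    p % 2 ^ (k + 1) = bif p.testBit k then 2 ^ k ^^^ p % 2 ^ k else p % 2 ^ k := by
  decide +kernel

lemma testBit_xorTranslate {p n : ℕ} (m : ℕ) (hp : p < 64) (hn : n < 4096) {k : ℕ} (hk : k ≤ 6) :
    (xorTranslate m p k).testBit n = m.testBit (n ^^^ p % 2 ^ k) := by
  induction k generalizing n with
  | zero => simp [xorTranslate, Nat.mod_one]
  | succ k ih =>
    rw [xor_mod_two_pow_succ p hp k (by omega), xorTranslate]
    cases p.testBit k with
    | false => exact ih hn (by omega)
    | true =>
      have h : n ^^^ 2 ^ k < 2 ^ 12 :=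
        Nat.xor_lt_two_pow hn (Nat.pow_lt_pow_right (by norm_num) (by omega))
      simp only [cond_true]
      rw [testBit_flipBit _ (by omega) hn, ih h (by omega), Nat.xor_assoc]

/-- Checks that the mask `h` contains no `p < k` for which it also contains the remaining points
of a line through the point with code `p`. -/
def noLineThrough (h : ℕ) : ℕ → Bool
  | 0 => true
  | p + 1 => (bif h.testBit p then
      h &&& xorTranslate h p 6 &&& xorTranslate h (mulOmega p) 6 &&&
        xorTranslate h (p ^^^ mulOmega p) 6 == 0
    else true) && noLineThrough h p

lemma mulOmega_lt : ∀ p < 64, mulOmega p < 64 := by decide +kernel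

lemma noLineThrough_spec {h k : ℕ} (hk : k ≤ 64) (hh : noLineThrough h k = true) {p q : ℕ}
    (hp : p < k) (hq : q < 4096) (hhp : h.testBit p = true) (hhq : h.testBit q = true)
    (h₁ : h.testBit (q ^^^ p) = true) (h₂ : h.testBit (q ^^^ mulOmega p) = true)
    (h₃ : h.testBit (q ^^^ (p ^^^ mulOmega p)) = true) : False := by
  induction k with
  | zero => omega
  | succ k ih =>
    rw [noLineThrough, Bool.and_eq_true] at hh
    rcases Nat.lt_succ_iff_lt_or_eq.1 hp with hlt | rfl
    · exact ih (by omega) hh.2 hlt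
    · have hp' : p < 64 := by omega
      have hm := mulOmega_lt p hp'
      have hx : p ^^^ mulOmega p < 64 := Nat.xor_lt_two_pow (n := 6) hp' hm
      have hz := hh.1
      rw [hhp, cond_true, beq_iff_eq] at hz
      have := congrArg (fun m => m.testBit q) hz
      simp only [Nat.testBit_and, testBit_xorTranslate _ hp' hq le_rfl,
        testBit_xorTranslate _ hm hq le_rfl, testBit_xorTranslate _ hx hq le_rfl, Nat.zero_testBit,
        show 2 ^ 6 = 64 from rfl, Nat.mod_eq_of_lt hp', Nat.mod_eq_of_lt hm,
        Nat.mod_eq_of_lt hx, hhq, h₁, h₂, h₃] at this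
      exact absurd this (by decide)

/-- Checks that the lines in the list are pairwise skew with all points in the mask `h`, and that
the points of `h` on none of them (the holes) contain no line. Holes with last coordinate zero
may only have their first three coordinates nonzero. -/
def checkLines : List (ℕ × ℕ) → ℕ → Bool
  | [], h => Nat.blt (h % 2 ^ 1024) (2 ^ 64) && noLineThrough h 64
  | l :: ls, h =>
    Nat.beq (Nat.land h (listMask (lineCodes l))) (listMask (lineCodes l)) &&
      checkLines ls (Nat.xor h (listMask (lineCodes l)))

lemma checkLines_spec {ls : List (ℕ × ℕ)} {h : ℕ} (hh : checkLines ls h = true) :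
    (∀ l ∈ ls, ∀ n ∈ lineCodes l, h.testBit n = true) ∧
    ls.Pairwise (fun l l' => ∀ n ∈ lineCodes l, n ∉ lineCodes l') ∧
    ∃ h', (h' % 2 ^ 1024 < 2 ^ 64 ∧ noLineThrough h' 64 = true) ∧
      ∀ n, h.testBit n = true → (∀ l ∈ ls, n ∉ lineCodes l) → h'.testBit n = true := by
  induction ls generalizing h with
  | nil =>
    rw [checkLines, Bool.and_eq_true] at hh
    exact ⟨by simp, List.Pairwise.nil, h, ⟨Nat.blt_eq ▸ hh.1, hh.2⟩,
      fun n hn _ => hn⟩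
  | cons l ls ih =>
    rw [checkLines, Bool.and_eq_true] at hh
    have hsub : ∀ n ∈ lineCodes l, h.testBit n = true := fun n hn => by
      have := congrArg (fun m => m.testBit n) (Nat.eq_of_beq_eq_true hh.1)
      rw [show Nat.land h _ = h &&& _ from rfl, Nat.testBit_and, (testBit_listMask _ n).2 hn,
        Bool.and_true] at this
      exact this
    obtain ⟨h₁, h₂, h', h₃, h₄⟩ := ih hh.2
    have hxor : ∀ n, (h ^^^ listMask (lineCodes l)).testBit n = true ↔
        h.testBit n = true ∧ n ∉ lineCodes l := fun n => by
      by_cases hn : n ∈ lineCodes l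
      · simp [hn, hsub n hn, (testBit_listMask _ n).2 hn]
      · have : (listMask (lineCodes l)).testBit n = false := by
          rw [← Bool.not_eq_true, testBit_listMask]; exact hn
        simp [hn, this]
    refine ⟨?_, List.pairwise_cons.2 ⟨fun l' hl' n hn hn' => ?_, h₂⟩, h', h₃, ?_⟩
    · rintro l' hl' n hn
      rcases List.mem_cons.1 hl' with rfl | hl'
      · exact hsub n hn
      · exact ((hxor n).1 (h₁ l' hl' n hn)).1
    · exact ((hxor n).1 (h₁ l' hl' n hn')).2 hn
    · exact fun n hn hls => h₄ n ((hxor n).2 ⟨hn, hls l (by simp)⟩)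
        fun l' hl' => hls l' (by simp [hl'])

end Masks

/-- The mask of all the codes of nonzero vectors. -/
def nonzeroCodes : ℕ := 2 ^ 4096 - (1 + 1)

lemma testBit_nonzeroCodes {n : ℕ} : nonzeroCodes.testBit n = true ↔ n ≠ 0 ∧ n < 4096 := by
  rw [nonzeroCodes, Nat.testBit_two_pow_sub_succ (Nat.one_lt_two_pow (by norm_num))]
  cases n <;> simp [Nat.testBit_succ]

/-- A two-dimensional subspace contains a nonzero vector with vanishing last coordinate. -/
lemma exists_mem_last_eq_zero {F : Type*} [Field F] {m : Submodule F (Fin 6 → F)}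
    (hm : Module.finrank F m = 2) : ∃ x ∈ m, x ≠ 0 ∧ x 5 = 0 := by
  let f : m →ₗ[F] F := (LinearMap.proj 5).comp m.subtype
  have h := f.finrank_range_add_finrank_ker
  have hr : Module.finrank F (LinearMap.range f) ≤ 1 := by
    simpa using (LinearMap.range f).finrank_le
  have hk : LinearMap.ker f ≠ ⊥ := fun hbot => by
    rw [hbot, finrank_bot] at h; omega
  obtain ⟨x, hx, hx0⟩ := Submodule.exists_mem_ne_zero_of_ne_bot hk
  exact ⟨x, x.2, by simpa using hx0, by simpa [f] using hx⟩

/-- The lines in a list that passes the check form a maximal partial line spread. -/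
theorem exists_isMaximalPartialLineSpread_of_checkLines {F : Type*} [Field F] [Fintype F]
    (hq : Fintype.card F = 4) {ls : List (ℕ × ℕ)} (hls : checkLines ls nonzeroCodes = true) :
    ∃ S : Set (Submodule F (Fin 6 → F)),
      IsMaximalPartialLineSpread F 6 S ∧ S.ncard = ls.length := by
  classical
  obtain ⟨h2, ω, hω⟩ := exists_omega hq
  obtain ⟨hcodes, hpair, h', ⟨hlow, hno⟩, hholes⟩ := checkLines_spec hls
  replace hcodes : ∀ l ∈ ls, ∀ n ∈ lineCodes l, n ≠ 0 ∧ n < 4096 :=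
    fun l hl n hn => testBit_nonzeroCodes.1 (hcodes l hl n hn)
  have hrank : ∀ l ∈ ls, Module.finrank F (lineSpan ω l) = 2 :=
    fun l hl => finrank_lineSpan h2 hω hq (hcodes l hl)
  have hskew : ls.Pairwise fun l l' => lineSpan ω l ⊓ lineSpan ω l' = ⊥ :=
    hpair.imp_of_mem fun hl hl' h => lineSpan_inf_eq_bot h2 hω hq
      (fun n hn => (hcodes _ hl n hn).2) (fun n hn => (hcodes _ hl' n hn).2) h
  have hnodup : (ls.map (lineSpan ω)).Nodup := by
    refine List.pairwise_map.2 (hskew.imp_of_mem fun hl _ h heq => ?_)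
    rw [← heq, inf_idem] at h
    have := hrank _ hl
    rw [h, finrank_bot] at this
    omega
  refine ⟨(ls.map (lineSpan ω)).toFinset, ⟨⟨?_, ?_⟩, ?_⟩, ?_⟩
  · intro l hl
    obtain ⟨l₀, hl₀, rfl⟩ := List.mem_map.1 (List.mem_toFinset.1 hl)
    exact hrank l₀ hl₀
  · intro l hl l' hl' hne
    have hp : (ls.map (lineSpan ω)).Pairwise fun x y => x ⊓ y = ⊥ := List.pairwise_map.2 hskew
    have : Std.Symm fun x y : Submodule F (Fin 6 → F) => x ⊓ y = ⊥ :=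
      ⟨fun _ _ h => by rwa [inf_comm]⟩
    exact hp.forall (List.mem_toFinset.1 hl) (List.mem_toFinset.1 hl') hne
  · intro m hm
    by_contra! hcon
    have hole : ∀ n < 4096, decodeVec ω n ∈ m → decodeVec ω n ≠ 0 → h'.testBit n = true := by
      intro n hn hnm hn0
      refine hholes n (testBit_nonzeroCodes.2 ⟨?_, hn⟩) fun l hl hnl => hn0 ?_
      · rintro rfl
        exact hn0 (by funext i; simp [decodeVec])
      · have := hcon (lineSpan ω l) (by simpa using ⟨_, _, hl, rfl⟩)
        exact (Submodule.eq_bot_iff _).1 this _ ⟨hnm, decodeVec_mem_lineSpan h2 hω hnl⟩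
    obtain ⟨x, hx, hx0, hx5⟩ := exists_mem_last_eq_zero hm
    obtain ⟨y, hy, hyx⟩ : ∃ y ∈ m, y ∉ Submodule.span F {x} := by
      by_contra! hle
      have := Submodule.finrank_mono (show m ≤ Submodule.span F {x} from hle)
      rw [hm, finrank_span_singleton hx0] at this
      omega
    obtain ⟨p, hp, rfl⟩ := exists_decodeVec_eq h2 hω hq x
    obtain ⟨q, hq', rfl⟩ := exists_decodeVec_eq h2 hω hq y
    have hp' : p < 2 ^ 10 := lt_two_pow_of_decodeVec hω 5 hp fun i hi => by
      rwa [show i = 5 from Fin.le_antisymm (Fin.le_last i) hi]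
    have hhp := hole p hp hx hx0
    have hp64 : p < 64 := by
      by_contra hge
      have hbit : (h' % 2 ^ 1024).testBit p = true := by
        rw [Nat.testBit_mod_two_pow, hhp, Bool.and_true, decide_eq_true_eq]
        exact hp'
      have h₁ := Nat.ge_two_pow_of_testBit hbit
      have h₂ : 2 ^ 64 ≤ 2 ^ p := Nat.pow_le_pow_right (by norm_num) (not_lt.1 hge)
      exact absurd hlow (not_lt.2 (h₂.trans h₁))
    have hadd : ∀ r < 64, ∀ c : F, decodeVec ω r = c • decodeVec ω p →
        h'.testBit (q ^^^ r) = true := by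
      intro r hr c hc
      have hv : decodeVec ω (q ^^^ r) = decodeVec ω q + c • decodeVec ω p := by
        rw [decodeVec_xor h2, hc]
      refine hole _ (Nat.xor_lt_two_pow (n := 12) hq' (by omega)) ?_ ?_
      · rw [hv]; exact add_mem hy (Submodule.smul_mem _ _ hx)
      · rw [hv]; intro h0
        refine hyx (Submodule.mem_span_singleton.2 ⟨-c, ?_⟩)
        rw [neg_smul]; exact (eq_neg_of_add_eq_zero_left h0).symm
    have hm64 := mulOmega_lt p hp64
    have hω' := decodeVec_mulOmega h2 hω p
    refine noLineThrough_spec le_rfl hno hp64 hq' hhp (hole q hq' hy ?_)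
      (hadd p hp64 1 (one_smul _ _).symm) (hadd _ hm64 ω hω')
      (hadd _ (Nat.xor_lt_two_pow (n := 6) hp64 hm64) (1 + ω) ?_)
    · rintro h0
      exact hyx (h0 ▸ zero_mem _)
    · rw [decodeVec_xor h2, hω', add_smul, one_smul]
  · rw [Set.ncard_coe_finset, List.toFinset_card_of_nodup hnodup, List.length_map]


/-! ### The configurations

A configuration consists of a partial spread of the solid of the vectors whose fourth and fifth
coordinates vanish, some fixed lines, and a choice, for each switch `(l, outs)`, between the line
`l` and the five lines `outs`. -/

section Configurations

/-- The fixed lines of the first family. -/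
def fixedLines : List (ℕ × ℕ) :=
  [(64, 256), (65, 299), (66, 317), (67, 278), (87, 262), (86, 301), (85, 315), (84, 272),
   (105, 267), (104, 288), (107, 310), (106, 285), (126, 269), (127, 294), (124, 304), (125, 283)]

/-- The fixed lines of the second family. -/
def denseFixedLines : List (ℕ × ℕ) :=
  [(66, 317), (67, 278), (69, 260), (70, 274), (74, 264), (75, 291), (76, 282), (78, 295),
   (81, 276), (82, 258), (84, 272), (85, 315), (86, 301), (87, 262), (88, 266), (90, 311),
   (94, 280), (95, 307), (98, 296), (99, 259), (100, 314), (102, 263), (103, 300), (104, 288),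
   (105, 267), (106, 285), (107, 310), (109, 292), (110, 306), (112, 298), (113, 257), (114, 279),
   (117, 302), (118, 312), (119, 275), (121, 308), (122, 290), (124, 304), (125, 283), (126, 269),
   (127, 294)]

/-- The switches of the first family. -/
def switches : List ((ℕ × ℕ) × List (ℕ × ℕ)) :=
  [((69, 260), [(69, 1304), (260, 1149), (321, 1157), (589, 1179), (841, 1251)]),
   ((70, 274), [(70, 1294), (274, 1150), (340, 1156), (613, 1178), (887, 1249)]),
   ((74, 264), [(74, 1816), (264, 1277), (322, 1093), (582, 1115), (846, 1187)]),
   ((75, 291), [(75, 1806), (291, 1278), (360, 1092), (634, 1114), (857, 1185)]),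
   ((76, 282), [(76, 1587), (282, 1212), (342, 1223), (611, 1241), (889, 1120)]),
   ((78, 295), [(78, 1573), (295, 1215), (361, 1222), (631, 1240), (848, 1122)]),
   ((81, 276), [(81, 1288), (276, 1129), (325, 1197), (633, 1203), (877, 1247)]),
   ((82, 258), [(82, 1310), (258, 1130), (336, 1196), (593, 1202), (851, 1245)]),
   ((88, 266), [(88, 1555), (266, 1172), (338, 1275), (599, 1253), (861, 1140)]),
   ((90, 311), [(90, 1541), (311, 1175), (365, 1274), (579, 1252), (884, 1142)]),
   ((94, 280), [(94, 1832), (280, 1217), (326, 1105), (626, 1103), (874, 1163)]),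
   ((95, 307), [(95, 1854), (307, 1218), (364, 1104), (590, 1102), (893, 1161)]),
   ((98, 296), [(98, 1800), (296, 1257), (330, 1133), (606, 1139), (886, 1183)]),
   ((99, 259), [(99, 1822), (259, 1258), (352, 1132), (610, 1138), (865, 1181)]),
   ((100, 314), [(100, 1539), (314, 1152), (350, 1235), (635, 1229), (833, 1096)]),
   ((102, 263), [(102, 1557), (263, 1155), (353, 1234), (623, 1228), (872, 1098)]),
   ((109, 292), [(109, 1336), (292, 1109), (329, 1209), (597, 1191), (881, 1271)]),
   ((110, 306), [(110, 1326), (306, 1110), (348, 1208), (637, 1190), (847, 1269)]),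
   ((112, 298), [(112, 1571), (298, 1192), (346, 1263), (591, 1265), (869, 1116)]),
   ((114, 279), [(114, 1589), (279, 1195), (357, 1262), (603, 1264), (844, 1118)]),
   ((118, 312), [(118, 1848), (312, 1237), (334, 1145), (618, 1127), (850, 1207)]),
   ((119, 275), [(119, 1838), (275, 1238), (356, 1144), (598, 1126), (837, 1205)]),
   ((121, 308), [(121, 1320), (308, 1089), (333, 1169), (609, 1167), (853, 1227)]),
   ((122, 290), [(122, 1342), (290, 1090), (344, 1168), (585, 1166), (875, 1225)]),
   ((68, 303), [(68, 1331), (303, 1148), (363, 1159), (625, 1177), (862, 1248)]),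
   ((71, 313), [(71, 1317), (313, 1151), (382, 1158), (601, 1176), (864, 1250)]),
   ((72, 309), [(72, 1843), (309, 1276), (381, 1095), (594, 1113), (871, 1184)]),
   ((73, 286), [(73, 1829), (286, 1279), (343, 1094), (622, 1112), (880, 1186)]),
   ((77, 305), [(77, 1550), (305, 1214), (380, 1220), (607, 1242), (878, 1121)]),
   ((79, 268), [(79, 1560), (268, 1213), (323, 1221), (587, 1243), (839, 1123)]),
   ((80, 319), [(80, 1315), (319, 1128), (367, 1199), (581, 1201), (890, 1244)]),
   ((83, 297), [(83, 1333), (297, 1131), (378, 1198), (621, 1200), (836, 1246)]),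
   ((89, 289), [(89, 1582), (289, 1174), (376, 1272), (619, 1254), (842, 1141)]),
   ((91, 284), [(91, 1592), (284, 1173), (327, 1273), (639, 1255), (867, 1143)]),
   ((92, 293), [(92, 1795), (293, 1216), (377, 1107), (614, 1101), (835, 1160)]),
   ((93, 270), [(93, 1813), (270, 1219), (339, 1106), (602, 1100), (852, 1162)]),
   ((96, 277), [(96, 1827), (277, 1256), (373, 1135), (586, 1137), (863, 1180)]),
   ((97, 318), [(97, 1845), (318, 1259), (351, 1134), (630, 1136), (840, 1182)]),
   ((101, 273), [(101, 1598), (273, 1154), (372, 1232), (583, 1230), (854, 1097)]),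
   ((103, 300), [(103, 1576), (300, 1153), (331, 1233), (595, 1231), (895, 1099)]),
   ((108, 271), [(108, 1299), (271, 1108), (355, 1211), (617, 1189), (870, 1268)]),
   ((111, 281), [(111, 1285), (281, 1111), (374, 1210), (577, 1188), (856, 1270)]),
   ((113, 257), [(113, 1566), (257, 1194), (368, 1260), (627, 1266), (882, 1117)]),
   ((115, 316), [(115, 1544), (316, 1193), (335, 1261), (615, 1267), (859, 1119)]),
   ((116, 261), [(116, 1811), (261, 1236), (369, 1147), (638, 1125), (891, 1204)]),
   ((117, 302), [(117, 1797), (302, 1239), (347, 1146), (578, 1124), (876, 1206)]),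
   ((120, 287), [(120, 1283), (287, 1088), (359, 1171), (605, 1165), (834, 1224)]),
   ((123, 265), [(123, 1301), (265, 1091), (370, 1170), (629, 1164), (892, 1226)])]

/-- The switches of the second family. -/
def denseSwitches : List ((ℕ × ℕ) × List (ℕ × ℕ)) :=
  [((64, 256), [(64, 1793), (256, 1381), (320, 1157), (576, 1762), (832, 1621)]),
   ((65, 299), [(65, 1597), (299, 1393), (362, 1636), (636, 2045), (855, 1209)]),
   ((93, 270), [(93, 1395), (270, 1496), (339, 1605), (602, 1999), (852, 1092)]),
   ((116, 261), [(116, 1469), (261, 1279), (369, 1598), (638, 2019), (891, 1297)]),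
   ((77, 305), [(77, 1595), (305, 1096), (380, 1220), (607, 1397), (878, 1518)]),
   ((89, 289), [(89, 1992), (289, 1904), (376, 1515), (619, 1255), (842, 1668)]),
   ((71, 313), [(71, 1511), (313, 1274), (382, 1262), (601, 1290), (864, 1250)]),
   ((73, 286), [(73, 1991), (286, 2003), (343, 1938), (622, 1778), (880, 1634)]),
   ((96, 277), [(96, 1870), (277, 1858), (373, 1562), (586, 1680), (863, 1662)]),
   ((79, 268), [(79, 1458), (268, 1964), (323, 1148), (587, 1460), (839, 1305)]),
   ((68, 303), [(68, 1987), (303, 1756), (363, 1753), (625, 1399), (862, 1101)]),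
   ((108, 271), [(108, 1389), (271, 1420), (355, 1954), (617, 1334), (870, 1827)]),
   ((92, 293), [(92, 1760), (293, 1895), (377, 1505), (614, 1434), (835, 1610)]),
   ((80, 319), [(80, 1451), (319, 2040), (367, 1315), (581, 1854), (890, 1658)]),
   ((120, 287), [(120, 1915), (287, 1145), (359, 1331), (605, 1856), (834, 1263)]),
   ((91, 284), [(91, 1499), (284, 1208), (327, 1327), (639, 1566), (867, 1513)]),
   ((97, 318), [(97, 1282), (318, 2027), (351, 1219), (630, 1885), (840, 1978)]),
   ((101, 273), [(101, 1737), (273, 1650), (372, 1949), (583, 1133), (854, 1267)]),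
   ((83, 297), [(83, 1483), (297, 1962), (378, 1633), (621, 1788), (836, 1246)]),
   ((72, 309), [(72, 1521), (309, 1606), (381, 1485), (594, 1823), (871, 1142)]),
   ((111, 281), [(111, 1843), (281, 1473), (374, 1816), (577, 1237), (856, 1538)]),
   ((123, 265), [(123, 1407), (265, 1353), (370, 1230), (629, 1192), (892, 1570)]),
   ((115, 316), [(115, 1452), (316, 1402), (335, 1815), (615, 1363), (859, 1184)])]

/-- A spread of the solid. -/
def solidLines17 : List (ℕ × ℕ) :=
  [(1, 4), (16, 1024), (17, 1028), (18, 1032), (19, 1036), (20, 1030), (21, 1026), (22, 1038),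
   (23, 1034), (24, 1035), (25, 1039), (26, 1027), (27, 1031), (28, 1037), (29, 1033), (30, 1029),
   (31, 1025)]

/-- A partial spread of size 14 of the solid. -/
def solidLines14 : List (ℕ × ℕ) :=
  [(1062, 19), (3116, 3091), (3095, 1043), (1024, 48), (44, 1038), (23, 53), (1053, 4),
   (1068, 3125), (3121, 2101), (3082, 40), (2097, 14), (1073, 1064), (2071, 3112), (1083, 39)]

/-- A partial spread of size 12 of the solid. -/
def solidLines12 : List (ℕ × ℕ) :=
  [(2066, 3080), (36, 1032), (2093, 48), (9, 3109), (45, 62), (3108, 2085), (3117, 3129),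
   (1069, 1079), (3090, 1061), (3135, 3091), (2057, 2056), (63, 2110)]

/-- A partial spread of size 11 of the solid. -/
def solidLines11 : List (ℕ × ℕ) :=
  [(46, 3077), (3118, 3120), (2093, 3113), (52, 48), (45, 2078), (2051, 1072), (1024, 29),
   (1076, 1031), (2094, 26), (1070, 1055), (1050, 3102)]

/-- The fixed lines, the lines of the first `j` switches and the five lines of the others. -/
def switchLines (fixed : List (ℕ × ℕ)) (sw : List ((ℕ × ℕ) × List (ℕ × ℕ))) (j : ℕ) :
    List (ℕ × ℕ) :=
  fixed ++ (sw.take j).map Prod.fst ++ (sw.drop j).flatMap Prod.snd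

/-- The lines outside the solid when `i` of the sets of five lines are switched to a line. -/
def familyLines (i : ℕ) : List (ℕ × ℕ) :=
  bif Nat.ble i 24 then switchLines fixedLines switches i
  else switchLines denseFixedLines denseSwitches (i - 25)

/-- A maximal partial line spread of size `n`. -/
def spreadLines (n : ℕ) : List (ℕ × ℕ) :=
  match n % 4 with
  | 0 => solidLines12 ++ familyLines ((268 - n) / 4)
  | 1 => solidLines17 ++ switchLines fixedLines switches ((273 - n) / 4)
  | 2 => solidLines14 ++ familyLines ((270 - n) / 4)
  | _ => solidLines11 ++ familyLines ((267 - n) / 4)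

/-- Checks that `spreadLines n` is a maximal partial line spread of size `n`. -/
def checkSize (n : ℕ) : Bool :=
  Nat.beq (spreadLines n).length n && checkLines (spreadLines n) nonzeroCodes

lemma checkSize_eighty_one_add {k : ℕ} (hk : k ≤ 19) : checkSize (81 + 4 * k) = true := by
  have h : ∀ n ∈ List.range' 81 20 4, checkSize n = true :=
    List.all_eq_true.1 (by decide +kernel)
  exact h _ (List.mem_range'.2 ⟨k, by omega, rfl⟩)

lemma checkSize_of_le_two_hundred_seventy {n : ℕ} (hn : 159 ≤ n) (hn' : n ≤ 270) :
    checkSize n = true := by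
  have h : ∀ n ∈ List.range' 159 112, checkSize n = true :=
    List.all_eq_true.1 (by decide +kernel)
  exact h n (List.mem_range'_1.2 ⟨hn, by omega⟩)

lemma checkSize_two_hundred_seventy_three : checkSize 273 = true := by
  decide +kernel

end Configurations

lemma exists_isMaximalPartialLineSpread_of_checkSize {F : Type*} [Field F] [Fintype F]
    (hq : Fintype.card F = 4) {n : ℕ} (hn : checkSize n = true) :
    ∃ S : Set (Submodule F (Fin 6 → F)), IsMaximalPartialLineSpread F 6 S ∧ S.ncard = n := by
  rw [checkSize, Bool.and_eq_true] at hn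
  obtain ⟨S, hS, hcard⟩ := exists_isMaximalPartialLineSpread_of_checkLines hq hn.2
  exact ⟨S, hS, hcard.trans (Nat.eq_of_beq_eq_true hn.1)⟩

/-- In PG(5,4), there exist maximal partial line spreads of size 81 + 4*k for
every integer k with 0 ≤ k ≤ 19, of every size n with 159 ≤ n ≤ 270, and of
size 273 (a spread). -/
theorem stmt12 (F : Type*) [Field F] [Fintype F] (hq : Fintype.card F = 4) :
    (∀ k : ℕ, k ≤ 19 → ∃ S : Set (Submodule F (Fin 6 → F)),
      IsMaximalPartialLineSpread F 6 S ∧ S.ncard = 81 + 4 * k) ∧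
    (∀ n : ℕ, 159 ≤ n → n ≤ 270 → ∃ S : Set (Submodule F (Fin 6 → F)),
      IsMaximalPartialLineSpread F 6 S ∧ S.ncard = n) ∧
    (∃ S : Set (Submodule F (Fin 6 → F)),
      IsMaximalPartialLineSpread F 6 S ∧ S.ncard = 273) := by
  refine ⟨fun k hk => ?_, fun n h₁ h₂ => ?_, ?_⟩
  · exact exists_isMaximalPartialLineSpread_of_checkSize hq (checkSize_eighty_one_add hk)
  · exact exists_isMaximalPartialLineSpread_of_checkSize hq
      (checkSize_of_le_two_hundred_seventy h₁ h₂)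
  · exact exists_isMaximalPartialLineSpread_of_checkSize hq checkSize_two_hundred_seventy_three
end
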